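/- arXiv:hep-th/9508079 — 2 statements merged into one kernel-verified Lean document; each statement's English description precedes it below -/
import Mathlib

section
/- For all integers r ≥ 3, a ∈ {1,…,r−1}, b ∈ {1,…,r−2} and L ≥ 0 with L − |a−b| a nonnegative even integer, the following polynomial identity (Melzer's identity) holds in the variable q: f_{a,b} · Σ_{m ≡ Q_{a,b}} q^{(1/4) mᵀC m − (1/2) m_{r−a−1}} ∏_{j=1}^{r−3} [ (1/2)(I m + L e_1 + e_{r−a−1} + e_{r−b−1})_j ; m_j ] = Σ_{j=−∞}^{∞} { q^{j(r(r−1)j + rb − (r−1)a)} [ L ; (1/2)(L+a−b) − rj ] − q^{((r−1)j+b)(rj+a)} [ L ; (1/2)(L−a−b) − rj ] }, where only finitely many terms of the sum over j are nonzero and all exponents appearing on both sides are integers. -/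
attribute [local instance] Classical.propDecidable

noncomputable section

variable {K : Type*} [Field K]

/-- `(q)_n` where `q = t^4` (the variable `t` stands for `q^{1/4}`). -/
def qp (t : K) (n : ℕ) : K :=
  ∏ k ∈ Finset.range n, (1 - t ^ (4 * (k + 1)))

/-- Gaussian polynomial `[N; m]` in the variable `q = t^4`. -/
def gauss (t : K) (N m : ℤ) : K :=
  if 0 ≤ m ∧ m ≤ N then qp t N.toNat / (qp t m.toNat * qp t (N - m).toNat) else 0

/-- Gaussian polynomial `[N2/2; m]` (zero if `N2` is odd). -/
def gaussHalf (t : K) (N2 m : ℤ) : K :=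
  if N2 % 2 = 0 then gauss t (N2 / 2) m else 0

/-- Incidence matrix of the Dynkin diagram `A_d` (indices `i : Fin d` stand for `i+1`). -/
def inc (d : ℕ) (i k : Fin d) : ℤ := if (i : ℕ) + 1 = (k : ℕ) ∨ (k : ℕ) + 1 = (i : ℕ) then 1 else 0

/-- Cartan matrix of `A_d`. -/
def cartan (d : ℕ) (i k : Fin d) : ℤ := (if i = k then 2 else 0) - inc d i k

/-- the `s`-th unit vector, with the convention `e_0 = e_{d+1} = 0`. -/
def uv (d : ℕ) (s : ℤ) (i : Fin d) : ℤ := if ((i : ℕ) : ℤ) + 1 = s then 1 else 0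

/-- `m_s`, with the conventions `m_0 = m_{d+1} = 0`. -/
def mAt (d : ℕ) (m : Fin d → ℕ) (s : ℤ) : ℤ := ∑ i, uv d s i * (m i : ℤ)

/-- `mᵀ C m` for the `A_d` Cartan matrix. -/
def quadC (d : ℕ) (m : Fin d → ℕ) : ℤ := ∑ i, ∑ k, (m i : ℤ) * cartan d i k * (m k : ℤ)

/-- the vector `Q_{a,b}`. -/
def Qab (r a b : ℕ) (i : Fin (r - 3)) : ℕ :=
  min (a - 1) (r - ((i : ℕ) + 1) - 2) + min (b - 1) (r - ((i : ℕ) + 1) - 2)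

/-- the parity restriction `m ≡ Q_{a,b} (mod 2)`. -/
def parity (r a b : ℕ) (m : Fin (r - 3) → ℕ) : Prop := ∀ i, m i % 2 = Qab r a b i % 2

/-- `(I m + L e_1 + e_{r-a-1} + e_{r-b-1})_i`. -/
def topE (r a b L : ℕ) (m : Fin (r - 3) → ℕ) (i : Fin (r - 3)) : ℤ :=
  (∑ k, inc (r - 3) i k * (m k : ℤ)) + (L : ℤ) * uv (r - 3) 1 i
    + uv (r - 3) ((r : ℤ) - a - 1) i + uv (r - 3) ((r : ℤ) - b - 1) i

/-- the summand `q^{(1/4) mᵀCm - (1/2) m_{r-a-1}} ∏_j [(1/2)(Im + Le_1 + e_{r-a-1} + e_{r-b-1})_j; m_j]`,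
in the variable `t = q^{1/4}`. -/
def fermTerm (r a b L : ℕ) (t : K) (m : Fin (r - 3) → ℕ) : K :=
  t ^ (quadC (r - 3) m - 2 * mAt (r - 3) m ((r : ℤ) - a - 1))
    * ∏ i, gaussHalf t (topE r a b L m i) (m i)

/-- the fermionic sum `Σ_{m ≡ Q_{a,b}} (⋯)`. -/
def fermSum (r a b L : ℕ) (t : K) : K :=
  ∑ᶠ m : Fin (r - 3) → ℕ, if parity r a b m then fermTerm r a b L t m else 0


section aux
variable {t : K}

/-- genericity of the parameter -/
def Gen (t : K) : Prop := t ≠ 0 ∧ ∀ n : ℕ, 0 < n → t ^ n ≠ 1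

lemma qp_succ (t : K) (n : ℕ) : qp t (n + 1) = qp t n * (1 - t ^ (4 * (n + 1))) := by
  simp [qp, Finset.prod_range_succ]

lemma qp_zero (t : K) : qp t 0 = 1 := by simp [qp]

lemma qp_ne (ht : Gen t) (n : ℕ) : qp t n ≠ 0 := by
  unfold qp
  rw [Finset.prod_ne_zero_iff]
  intro k _ h
  exact ht.2 (4 * (k + 1)) (by omega) (by linear_combination -h)

lemma gauss_nat (t : K) (k l : ℕ) : gauss t ((k : ℤ) + l) k = qp t (k + l) / (qp t k * qp t l) := by
  unfold gauss
  rw [if_pos (by omega)]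
  have h1 : ((k : ℤ) + l).toNat = k + l := by omega
  have h2 : ((k : ℤ) + l - k).toNat = l := by omega
  rw [h1, h2, Int.toNat_natCast]

lemma gauss_zero_of (t : K) {N m : ℤ} (h : ¬ (0 ≤ m ∧ m ≤ N)) : gauss t N m = 0 := by
  unfold gauss; rw [if_neg h]

lemma gauss_symm (t : K) (N m : ℤ) : gauss t N (N - m) = gauss t N m := by
  by_cases h : 0 ≤ m ∧ m ≤ N
  · obtain ⟨k, rfl⟩ := Int.eq_ofNat_of_zero_le h.1
    obtain ⟨l, hl⟩ := Int.eq_ofNat_of_zero_le (sub_nonneg.2 h.2)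
    obtain rfl : N = (k : ℤ) + l := by omega
    have e : (k : ℤ) + l - k = l := by ring
    rw [e, gauss_nat, add_comm (k : ℤ), gauss_nat, add_comm l k, mul_comm]
  · rw [gauss_zero_of t h, gauss_zero_of t (by omega)]

lemma gauss_zero_right (ht : Gen t) {N : ℤ} (h : 0 ≤ N) : gauss t N 0 = 1 := by
  obtain ⟨k, rfl⟩ := Int.eq_ofNat_of_zero_le h
  have := gauss_nat t 0 k
  simp only [Nat.cast_zero, zero_add, qp_zero, one_mul, div_self (qp_ne ht k)] at this
  exact this

lemma gauss_self (ht : Gen t) {N : ℤ} (h : 0 ≤ N) : gauss t N N = 1 := by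
  rw [← gauss_symm, sub_self, gauss_zero_right ht h]

lemma gauss_pascal1 (ht : Gen t) {N : ℤ} (hN : 0 ≤ N) (m : ℤ) :
    gauss t (N + 1) m = gauss t N m + t ^ (4 * (N + 1 - m)) * gauss t N (m - 1) := by
  by_cases h0 : m < 0
  · rw [gauss_zero_of t (by omega), gauss_zero_of t (by omega), gauss_zero_of t (by omega)]; simp
  by_cases h1 : N + 1 < m
  · rw [gauss_zero_of t (by omega), gauss_zero_of t (by omega), gauss_zero_of t (by omega)]; simp
  rcases eq_or_ne m 0 with rfl | h2
  · rw [gauss_zero_right ht hN, gauss_zero_right ht (by omega), gauss_zero_of t (by omega)]; simp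
  rcases eq_or_ne m (N + 1) with rfl | h3
  · rw [gauss_self ht (by omega), gauss_zero_of t (by omega), add_sub_cancel_right,
      gauss_self ht hN]; simp
  obtain ⟨k, hk⟩ := Int.eq_ofNat_of_zero_le (show 0 ≤ m - 1 by omega)
  obtain ⟨l, hl⟩ := Int.eq_ofNat_of_zero_le (show 0 ≤ N - m by omega)
  obtain rfl : m = ((k + 1 : ℕ) : ℤ) := by push_cast; omega
  obtain rfl : N = ((k + 1 : ℕ) : ℤ) + l := by push_cast at *; omega
  have e1 : ((k + 1 : ℕ) : ℤ) + l + 1 = ((k + 1 : ℕ) : ℤ) + (l + 1 : ℕ) := by push_cast; ring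
  have e2 : ((k + 1 : ℕ) : ℤ) + l = (k : ℤ) + (l + 1 : ℕ) := by push_cast; ring
  have e3 : ((k + 1 : ℕ) : ℤ) - 1 = k := by push_cast; ring
  have e4 : 4 * (((k + 1 : ℕ) : ℤ) + (l + 1 : ℕ) - (k + 1 : ℕ)) = ((4 * (l + 1) : ℕ) : ℤ) := by
    push_cast; ring
  rw [e1, gauss_nat, gauss_nat, e4, e3, e2, gauss_nat, zpow_natCast]
  have e5 : k + 1 + (l + 1) = (k + 1 + l) + 1 := by ring
  have e6 : k + (l + 1) = k + 1 + l := by ring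
  rw [e5, e6, qp_succ t (k + 1 + l), qp_succ t k, qp_succ t l]
  have n1 := qp_ne ht k
  have n2 := qp_ne ht l
  have n3 : (1 - t ^ (4 * (k + 1))) ≠ 0 := fun h => ht.2 (4 * (k + 1)) (by omega) (by linear_combination -h)
  have n4 : (1 - t ^ (4 * (l + 1))) ≠ 0 := fun h => ht.2 (4 * (l + 1)) (by omega) (by linear_combination -h)
  have e7 : t ^ (4 * (k + 1 + l + 1)) = t ^ (4 * (k + 1)) * t ^ (4 * (l + 1)) := by
    rw [← pow_add]; congr 1; ring
  rw [e7]
  generalize t ^ (4 * (k + 1)) = u at *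
  generalize t ^ (4 * (l + 1)) = v at *
  field_simp
  ring

lemma gauss_pascal2 (ht : Gen t) {N : ℤ} (hN : 0 ≤ N) (m : ℤ) :
    gauss t (N + 1) m = gauss t N (m - 1) + t ^ (4 * m) * gauss t N m := by
  rw [← gauss_symm, gauss_pascal1 ht hN, ← gauss_symm t N (m - 1), ← gauss_symm t N m]
  have e1 : N + 1 - m = N - (m - 1) := by ring
  have e2 : N + 1 - (N - (m - 1)) = m := by ring
  have e3 : N - (m - 1) - 1 = N - m := by ring
  rw [e1, e2, e3]

/-- trinomial revision -/
lemma gauss_tri (ht : Gen t) (N m l : ℤ) :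
    gauss t N m * gauss t m l = gauss t N l * gauss t (N - l) (m - l) := by
  by_cases h : 0 ≤ l ∧ l ≤ m ∧ m ≤ N
  · obtain ⟨a, rfl⟩ := Int.eq_ofNat_of_zero_le h.1
    obtain ⟨b, hb⟩ := Int.eq_ofNat_of_zero_le (sub_nonneg.2 h.2.1)
    obtain ⟨c, hc⟩ := Int.eq_ofNat_of_zero_le (sub_nonneg.2 h.2.2)
    obtain rfl : m = (a : ℤ) + b := by omega
    obtain rfl : N = (a : ℤ) + b + c := by omega
    have e1 : (a : ℤ) + b + c = ((a + b : ℕ) : ℤ) + c := by push_cast; ring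
    have e2 : (a : ℤ) + b + c = (a : ℤ) + (b + c : ℕ) := by push_cast; ring
    have e3 : (a : ℤ) + b + c - a = (b : ℤ) + c := by push_cast; ring
    have e4 : (a : ℤ) + b - a = (b : ℤ) := by push_cast; ring
    have h1 := gauss_nat t (a + b) c
    have h2 := gauss_nat t a (b + c)
    rw [← e1, Nat.cast_add] at h1
    rw [← e2] at h2
    rw [e3, e4, gauss_nat, gauss_nat, h1, h2]
    have := qp_ne ht a
    have := qp_ne ht b
    have := qp_ne ht c
    have := qp_ne ht (a + b)
    have := qp_ne ht (b + c)
    rw [← add_assoc a b c]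
    field_simp
  · by_cases h1 : 0 ≤ l ∧ l ≤ m
    · rw [gauss_zero_of t (N := N) (m := m) (by omega), gauss_zero_of t (N := N - l) (by omega)]; simp
    · rw [gauss_zero_of t (N := m) (by omega)]
      by_cases h2 : 0 ≤ l
      · rw [gauss_zero_of t (N := N - l) (by omega)]; simp
      · rw [gauss_zero_of t (N := N) (m := l) (by omega)]; simp

/-- q-Vandermonde -/
lemma gauss_vander (ht : Gen t) (A : ℕ) (B : ℤ) (hB : 0 ≤ B) (D : ℤ) (n : ℕ) (hn : A < n) :
    ∑ i ∈ Finset.range n, t ^ (4 * ((i : ℤ) * (i + B - D))) * gauss t A i * gauss t B (D - i)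
      = gauss t (A + B) D := by
  induction A generalizing D n with
  | zero =>
    rw [Finset.sum_eq_single 0]
    · simp [gauss_zero_right ht]
    · intro i _ hi
      rw [gauss_zero_of t (N := ((0 : ℕ) : ℤ)) (by omega)]; simp
    · intro h; simp at h; omega
  | succ A ih =>
    have hA : (0 : ℤ) ≤ (A : ℤ) := by omega
    have step : ∀ i : ℕ, t ^ (4 * ((i : ℤ) * (i + B - D))) * gauss t ((A + 1 : ℕ) : ℤ) i * gauss t B (D - i)
        = t ^ (4 * ((i : ℤ) * (i + B - D))) * gauss t A i * gauss t B (D - i)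
          + t ^ (4 * ((i : ℤ) * (i + B - D))) * t ^ (4 * ((A : ℤ) + 1 - i)) * gauss t A (i - 1) * gauss t B (D - i) := by
      intro i
      rw [Nat.cast_succ, gauss_pascal1 ht hA]; ring
    rw [Finset.sum_congr rfl (fun i _ => step i), Finset.sum_add_distrib, ih D n (by omega)]
    obtain ⟨n', rfl⟩ : ∃ n', n = n' + 1 := ⟨n - 1, by omega⟩
    rw [Finset.sum_range_succ']
    have z : gauss t A (((0 : ℕ) : ℤ) - 1) = 0 := gauss_zero_of t (by omega)
    rw [z]
    have e : ((A + 1 : ℕ) : ℤ) + B = (A + B) + 1 := by push_cast; ring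
    rw [e, gauss_pascal1 ht (by omega) D, ← ih (D - 1) n' (by omega), Finset.mul_sum]
    simp only [mul_zero, zero_mul, add_zero]
    congr 1
    apply Finset.sum_congr rfl
    intro i _
    have e1 : ((i + 1 : ℕ) : ℤ) - 1 = i := by push_cast; ring
    have e2 : D - ((i + 1 : ℕ) : ℤ) = D - 1 - i := by push_cast; ring
    have e3 : t ^ (4 * (((i + 1 : ℕ) : ℤ) * (((i + 1 : ℕ) : ℤ) + B - D))) * t ^ (4 * ((A : ℤ) + 1 - ((i + 1 : ℕ) : ℤ)))
        = t ^ (4 * ((A : ℤ) + B + 1 - D)) * t ^ (4 * ((i : ℤ) * (i + B - (D - 1)))) := by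
      rw [← zpow_add₀ ht.1, ← zpow_add₀ ht.1]; congr 1; push_cast; ring
    rw [e1, e2, e3]; ring

/-- q-Saalschütz, in the Burge form -/
lemma gauss_saal (ht : Gen t) (A B C D : ℕ) (n : ℕ) (hn : A < n) :
    ∑ i ∈ Finset.range n, t ^ (4 * ((i : ℤ) * (i + B - D))) * gauss t A i * gauss t B (D - i)
        * gauss t (C + D - i) (A + B)
      = gauss t C (A + B - D) * gauss t (C - A + D) D := by
  have step : ∀ i ∈ Finset.range n, t ^ (4 * ((i : ℤ) * (i + B - D))) * gauss t A i * gauss t B (D - i)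
        * gauss t (C + D - i) (A + B)
      = ∑ l ∈ Finset.range (D + B + 1), t ^ (4 * ((l : ℤ) * (l + C - (A + B)))) * gauss t C (A + B - l) * gauss t B l *
        (t ^ (4 * ((i : ℤ) * (i + (B - l) - (D - l)))) * gauss t A i * gauss t (B - l) (D - l - i)) := by
    intro i _
    by_cases hi : (D : ℤ) - i < 0
    · rw [gauss_zero_of t (N := (B : ℤ)) (m := D - i) (by omega)]
      rw [Finset.sum_eq_zero]
      · simp
      · intro l _
        rw [gauss_zero_of t (N := (B : ℤ) - l) (m := D - l - i) (by omega)]; simp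
    · have h1 : (C : ℤ) + D - i = ((D - i : ℕ) : ℤ) + C := by omega
      have h2 : (D : ℤ) - i = ((D - i : ℕ) : ℤ) := by omega
      rw [h1, ← gauss_vander ht (D - i) C (by omega) (A + B) (D + B + 1) (by omega), Finset.mul_sum]
      apply Finset.sum_congr rfl
      intro l _
      have h3 := gauss_tri ht (B : ℤ) ((D - i : ℕ) : ℤ) l
      have h4 : (i : ℤ) + (B - l) - (D - l) = i + B - D := by ring
      have h5 : (D : ℤ) - l - i = ((D - i : ℕ) : ℤ) - l := by omega
      rw [h2, h4, h5]
      linear_combination (t ^ (4 * ((i : ℤ) * (i + B - D))) * gauss t A i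
        * (t ^ (4 * ((l : ℤ) * (l + C - (A + B)))) * gauss t C (A + B - l))) * h3
  rw [Finset.sum_congr rfl step, Finset.sum_comm]
  by_cases hC : (C : ℤ) < A + B - D
  · rw [gauss_zero_of t (N := (C : ℤ)) (m := A + B - D) (by omega), zero_mul]
    apply Finset.sum_eq_zero
    intro l _
    apply Finset.sum_eq_zero
    intro i _
    by_cases hl : (C : ℤ) < A + B - l
    · rw [gauss_zero_of t (N := (C : ℤ)) (m := A + B - l) (by omega)]; simp
    · rw [gauss_zero_of t (N := (B : ℤ) - l) (m := D - l - i) (by omega)]; simp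
  have e : (C : ℤ) - A + D = (B : ℤ) + (C - A - B + D) := by ring
  rw [e, ← gauss_vander ht B ((C : ℤ) - A - B + D) (by omega) D (D + B + 1) (by omega), Finset.mul_sum]
  apply Finset.sum_congr rfl
  intro l _
  rw [← Finset.mul_sum]
  by_cases hl : (B : ℤ) - l < 0
  · rw [gauss_zero_of t (N := (B : ℤ)) (m := l) (by omega)]; simp
  rw [gauss_vander ht A ((B : ℤ) - l) (by omega) (D - l) n hn]
  have h3 := gauss_tri ht (C : ℤ) (A + B - l) (A + B - D)
  have h4 : (A : ℤ) + (B - l) = A + B - l := by ring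
  have h5 : gauss t ((A : ℤ) + B - l) (D - l) = gauss t ((A : ℤ) + B - l) (A + B - D) := by
    rw [← gauss_symm]; congr 1; ring
  have h6 : (C : ℤ) - (A + B - D) = C - A - B + D := by ring
  have h7 : gauss t ((C : ℤ) - A - B + D) (A + B - l - (A + B - D)) =
      gauss t ((C : ℤ) - A - B + D) (D - l) := by
    congr 1; ring
  rw [h6, h7] at h3
  have h8 : (l : ℤ) + (C - A - B + D) - D = l + C - (A + B) := by ring
  rw [h4, h5, h8]
  linear_combination (t ^ (4 * ((l : ℤ) * (l + C - (A + B)))) * gauss t B l) * h3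

/-- Gaussian polynomial with doubled arguments -/
def gh (t : K) (N m : ℤ) : K := if N % 2 = 0 ∧ m % 2 = 0 then gauss t (N / 2) (m / 2) else 0

lemma gh_two (t : K) (N m : ℤ) : gh t (2 * N) (2 * m) = gauss t N m := by
  unfold gh
  rw [if_pos (by omega)]
  congr 1 <;> omega

lemma gaussHalf_eq (t : K) (N m : ℤ) : gaussHalf t N m = gh t N (2 * m) := by
  unfold gh gaussHalf
  by_cases h : N % 2 = 0
  · rw [if_pos h, if_pos (by omega)]; congr 1; omega
  · rw [if_neg h, if_neg (by omega)]

lemma gh_zero (t : K) {N m : ℤ} (h : ¬ (N % 2 = 0 ∧ m % 2 = 0 ∧ 0 ≤ m ∧ m ≤ N)) : gh t N m = 0 := by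
  unfold gh
  by_cases h1 : N % 2 = 0 ∧ m % 2 = 0
  · rw [if_pos h1, gauss_zero_of t (by omega)]
  · rw [if_neg h1]

lemma gh_ne {t : K} {N m : ℤ} (h : gh t N m ≠ 0) : N % 2 = 0 ∧ m % 2 = 0 ∧ 0 ≤ m ∧ m ≤ N := by
  by_contra h1
  exact h (gh_zero t h1)

lemma gh_pascal1 (ht : Gen t) {N m : ℤ} (hN : ¬ (N = -2 ∧ m = 0)) :
    gh t (N + 2) m = gh t N m + t ^ (2 * (N + 2 - m)) * gh t N (m - 2) := by
  by_cases h : N % 2 = 0 ∧ m % 2 = 0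
  · obtain ⟨n, rfl⟩ : ∃ n, N = 2 * n := ⟨N / 2, by omega⟩
    obtain ⟨k, rfl⟩ : ∃ k, m = 2 * k := ⟨m / 2, by omega⟩
    by_cases hn : 0 ≤ n
    · have e1 : 2 * n + 2 = 2 * (n + 1) := by ring
      have e2 : 2 * k - 2 = 2 * (k - 1) := by ring
      rw [e1, e2, gh_two, gh_two, gh_two, gauss_pascal1 ht hn]
      congr 3; ring
    · rw [gh_zero t (by omega), gh_zero t (by omega), gh_zero t (by omega)]; simp
  · rw [gh_zero t (by omega), gh_zero t (by omega), gh_zero t (by omega)]; simp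

lemma gh_pascal2 (ht : Gen t) {N m : ℤ} (hN : ¬ (N = -2 ∧ m = 0)) :
    gh t (N + 2) m = gh t N (m - 2) + t ^ (2 * m) * gh t N m := by
  by_cases h : N % 2 = 0 ∧ m % 2 = 0
  · obtain ⟨n, rfl⟩ : ∃ n, N = 2 * n := ⟨N / 2, by omega⟩
    obtain ⟨k, rfl⟩ : ∃ k, m = 2 * k := ⟨m / 2, by omega⟩
    by_cases hn : 0 ≤ n
    · have e1 : 2 * n + 2 = 2 * (n + 1) := by ring
      have e2 : 2 * k - 2 = 2 * (k - 1) := by ring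
      rw [e1, e2, gh_two, gh_two, gh_two, gauss_pascal2 ht hn]
      congr 3; ring
    · rw [gh_zero t (by omega), gh_zero t (by omega), gh_zero t (by omega)]; simp
  · rw [gh_zero t (by omega), gh_zero t (by omega), gh_zero t (by omega)]; simp

/-- the basic bosonic building block -/
def TT (t : K) (x y α γ : ℤ) : K := gh t (y + γ) (x + α) * gh t (y - γ) (x - α)

lemma TT_ne {t : K} {x y α γ : ℤ} (h : TT t x y α γ ≠ 0) :
    (y + γ) % 2 = 0 ∧ (x + α) % 2 = 0 ∧ 0 ≤ x + α ∧ 0 ≤ x - α ∧ x + α ≤ y + γ ∧ x - α ≤ y - γ := by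
  have h1 := gh_ne (left_ne_zero_of_mul h)
  have h2 := gh_ne (right_ne_zero_of_mul h)
  omega

lemma TT_zero {t : K} {x y α γ : ℤ} (h : ¬ ((y + γ) % 2 = 0 ∧ (x + α) % 2 = 0 ∧ 0 ≤ x + α ∧ 0 ≤ x - α
    ∧ x + α ≤ y + γ ∧ x - α ≤ y - γ)) : TT t x y α γ = 0 := by
  by_contra h1
  exact h (TT_ne h1)

lemma TT_neg (t : K) (x y α γ : ℤ) : TT t x y (-α) (-γ) = TT t x y α γ := by
  unfold TT
  rw [mul_comm, sub_neg_eq_add, sub_neg_eq_add, ← sub_eq_add_neg, ← sub_eq_add_neg]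

/-- the Burge transform -/
lemma burge (ht : Gen t) (y z : ℕ) (z' : ℤ) (hz : z' = z) (α γ : ℤ) (hs : (0 ≤ α ∧ γ ≤ α) ∨ (α ≤ 0 ∧ α ≤ γ)) :
    ∑ x ∈ Finset.range (y + 3), t ^ (((y : ℤ) - x) ^ 2) * gh t (x + z') (2 * y) * TT t x y α γ
      = t ^ ((α - γ) ^ 2) * TT t y z' (2 * α - γ) α := by
  subst hz
  by_cases hz : (y + γ) % 2 = 0 ∧ ((z : ℤ) + α) % 2 = 0 ∧ -γ ≤ y ∧ γ ≤ y ∧ 2 * α ≤ y + γ ∧ 0 ≤ (z : ℤ) + α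
  · obtain ⟨A, hA⟩ : ∃ A : ℕ, (y : ℤ) + γ = 2 * A := ⟨((y + γ) / 2).toNat, by omega⟩
    obtain ⟨B, hB⟩ : ∃ B : ℕ, (y : ℤ) - γ = 2 * B := ⟨((y - γ) / 2).toNat, by omega⟩
    obtain ⟨C, hC⟩ : ∃ C : ℕ, (z : ℤ) + α = 2 * C := ⟨((z + α) / 2).toNat, by omega⟩
    obtain ⟨D, hD⟩ : ∃ D : ℕ, (A : ℤ) - α = D := ⟨((A : ℤ) - α).toNat, by omega⟩
    have R : TT t y z (2 * α - γ) α = gauss t C (A + B - D) * gauss t (C - A + D) D := by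
      unfold TT
      rw [show (z : ℤ) + α = 2 * C by omega, show (y : ℤ) + (2 * α - γ) = 2 * (A + B - D) by omega,
        show (z : ℤ) - α = 2 * (C - A + D) by omega, show (y : ℤ) - (2 * α - γ) = 2 * D by omega,
        gh_two, gh_two]
    rw [R, ← gauss_saal ht A B C D (A + 1) (by omega), Finset.mul_sum]
    have key : ∀ (x i : ℕ), (x : ℤ) = 2 * D + α - 2 * i →
        t ^ (((y : ℤ) - x) ^ 2) * gh t (x + z) (2 * y) * TT t x y α γ =
        t ^ ((α - γ) ^ 2) * (t ^ (4 * ((i : ℤ) * (i + B - D))) * gauss t A i * gauss t B (D - i)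
        * gauss t (C + D - i) (A + B)) := by
      intro x i hx
      unfold TT
      rw [show (x : ℤ) + z = 2 * (C + D - i) by omega, show 2 * (y : ℤ) = 2 * (A + B) by omega,
        show (y : ℤ) + γ = 2 * A by omega, show (x : ℤ) + α = 2 * (A - i) by omega,
        show (y : ℤ) - γ = 2 * B by omega, show (x : ℤ) - α = 2 * (D - i) by omega,
        gh_two, gh_two, gh_two, gauss_symm]
      have e : t ^ (((y : ℤ) - x) ^ 2) = t ^ ((α - γ) ^ 2) * t ^ (4 * ((i : ℤ) * (i + B - D))) := by
        rw [← zpow_add₀ ht.1]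
        congr 1
        rw [show (y : ℤ) - x = 2 * i + (B - D) by omega, show α - γ = B - D by omega]
        ring
      rw [e]; ring
    refine Finset.sum_bij_ne_zero (fun x _ _ => ((2 * D + α - x) / 2).toNat) ?_ ?_ ?_ ?_
    · intro x _ h
      have := TT_ne (right_ne_zero_of_mul h)
      simp only [Finset.mem_range]; omega
    · intro x _ h x' _ h' e
      have := TT_ne (right_ne_zero_of_mul h)
      have := TT_ne (right_ne_zero_of_mul h')
      omega
    · intro i hi h
      have h1 := right_ne_zero_of_mul h
      have h2 : gauss t B (D - i) ≠ 0 := right_ne_zero_of_mul (left_ne_zero_of_mul h1)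
      have h3 : 0 ≤ (D : ℤ) - i ∧ (D : ℤ) - i ≤ B := by
        by_contra h4; exact h2 (gauss_zero_of t h4)
      have hi' := Finset.mem_range.1 hi
      have hx : ((2 * (D : ℤ) + α - 2 * i).toNat : ℤ) = 2 * D + α - 2 * i := by omega
      refine ⟨(2 * (D : ℤ) + α - 2 * i).toNat, ?_, ?_, ?_⟩
      · simp only [Finset.mem_range]; omega
      · rw [key _ i hx]; exact h
      · simp only [hx]; omega
    · intro x _ h
      have := TT_ne (right_ne_zero_of_mul h)
      exact key x _ (by omega)
  · rw [TT_zero (x := y), mul_zero]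
    · apply Finset.sum_eq_zero
      intro x _
      by_contra h
      have h1 := TT_ne (right_ne_zero_of_mul h)
      have h2 := gh_ne (right_ne_zero_of_mul (left_ne_zero_of_mul h))
      omega
    · omega

/-- the last step -/
lemma lastStep (ht : Gen t) (y : ℕ) (α γ : ℤ) (hs : (0 ≤ α ∧ γ ≤ α) ∨ (α ≤ 0 ∧ α ≤ γ)) :
    ∑ x ∈ Finset.range (y + 3), t ^ ((x : ℤ) ^ 2) * TT t x y α γ
      = t ^ (α ^ 2) * gh t (2 * y) (y - γ + 2 * α) := by
  by_cases hz : (y + γ) % 2 = 0 ∧ -γ ≤ y ∧ γ ≤ y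
  · obtain ⟨A, hA⟩ : ∃ A : ℕ, (y : ℤ) + γ = 2 * A := ⟨((y + γ) / 2).toNat, by omega⟩
    obtain ⟨B, hB⟩ : ∃ B : ℕ, (y : ℤ) - γ = 2 * B := ⟨((y - γ) / 2).toNat, by omega⟩
    rw [show 2 * (y : ℤ) = 2 * (A + B) by omega, show (y : ℤ) - γ + 2 * α = 2 * (B + α) by omega,
      gh_two, ← gauss_vander ht A B (by omega) (B + α) (A + 1) (by omega), Finset.mul_sum]
    have key : ∀ (x i : ℕ), (x : ℤ) = 2 * i - α →
        t ^ ((x : ℤ) ^ 2) * TT t x y α γ =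
        t ^ (α ^ 2) * (t ^ (4 * ((i : ℤ) * (i + B - (B + α)))) * gauss t A i * gauss t B (B + α - i)) := by
      intro x i hx
      unfold TT
      rw [show (y : ℤ) + γ = 2 * A by omega, show (x : ℤ) + α = 2 * i by omega,
        show (y : ℤ) - γ = 2 * B by omega, show (x : ℤ) - α = 2 * (i - α) by omega,
        gh_two, gh_two, ← gauss_symm t B, show (B : ℤ) - (i - α) = B + α - i by ring]
      have e : t ^ ((x : ℤ) ^ 2) = t ^ (α ^ 2) * t ^ (4 * ((i : ℤ) * (i + B - (B + α)))) := by
        rw [← zpow_add₀ ht.1, hx]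
        congr 1
        ring
      rw [e]; ring
    refine Finset.sum_bij_ne_zero (fun x _ _ => ((x + α) / 2).toNat) ?_ ?_ ?_ ?_
    · intro x _ h
      have := TT_ne (right_ne_zero_of_mul h)
      simp only [Finset.mem_range]; omega
    · intro x _ h x' _ h' e
      have := TT_ne (right_ne_zero_of_mul h)
      have := TT_ne (right_ne_zero_of_mul h')
      omega
    · intro i hi h
      have h1 := right_ne_zero_of_mul h
      have h2 : gauss t B (B + α - i) ≠ 0 := right_ne_zero_of_mul h1
      have h3 : 0 ≤ (B : ℤ) + α - i ∧ (B : ℤ) + α - i ≤ B := by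
        by_contra h4; exact h2 (gauss_zero_of t h4)
      have hi' := Finset.mem_range.1 hi
      have hx : ((2 * (i : ℤ) - α).toNat : ℤ) = 2 * i - α := by omega
      refine ⟨(2 * (i : ℤ) - α).toNat, ?_, ?_, ?_⟩
      · simp only [Finset.mem_range]; omega
      · rw [key _ i hx]; exact h
      · simp only [hx]; omega
    · intro x _ h
      have := TT_ne (right_ne_zero_of_mul h)
      exact key x _ (by omega)
  · rw [gh_zero, mul_zero]
    · apply Finset.sum_eq_zero
      intro x _
      by_contra h
      have h1 := TT_ne (right_ne_zero_of_mul h)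
      omega
    · omega

/-- bosonic families -/
def SS (t : K) (k c h l m x y : ℤ) : K :=
  ∑ᶠ j : ℤ, t ^ (4 * k * j ^ 2 + l * j + m) * TT t x y (2 * k * j + c) (2 * (k - 1) * j + c - h)

lemma kj_cases (k j : ℤ) (hk : 1 ≤ k) :
    (j = 0 ∧ k * j = 0) ∨ (1 ≤ j ∧ k ≤ k * j ∧ j ≤ k * j) ∨ (j ≤ -1 ∧ k * j ≤ -k ∧ k * j ≤ j) := by
  rcases lt_trichotomy j 0 with h | h | h
  · right; right
    refine ⟨by omega, by nlinarith, by nlinarith⟩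
  · left; simp [h]
  · right; left
    refine ⟨by omega, by nlinarith, by nlinarith⟩

lemma SS_fin (t : K) (k c x : ℤ) (hk : 1 ≤ k) (f : ℤ → K) (g : ℤ → ℤ) (y : ℤ → ℤ) :
    (Function.support fun j : ℤ => f j * TT t x (y j) (2 * k * j + c) (g j)).Finite := by
  apply (Set.finite_Icc (-(x + |c|)) (x + |c|)).subset
  intro j hj
  have h := TT_ne (right_ne_zero_of_mul hj)
  have hc := abs_le.1 (le_refl |c|)
  have := kj_cases k j hk
  have e : 2 * k * j = 2 * (k * j) := by ring
  rw [e] at h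
  simp only [Set.mem_Icc]
  omega

lemma SS_reflect (t : K) (k c h l m x y : ℤ) : SS t k c h l m x y = SS t k (-c) (-h) (-l) m x y := by
  unfold SS
  rw [← finsum_comp_equiv (Equiv.neg ℤ)]
  apply finsum_congr
  intro j
  simp only [Equiv.neg_apply]
  rw [← TT_neg t x y (2 * k * -j + c)]
  congr 2 <;> ring

lemma SS_shift (t : K) (k c h l m x y : ℤ) :
    SS t k c h l m x y = SS t k (c + 2 * k) (h + 2) (l + 8 * k) (m + 4 * k + l) x y := by
  unfold SS
  rw [← finsum_comp_equiv (Equiv.addRight (1 : ℤ))]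
  apply finsum_congr
  intro j
  simp only [Equiv.coe_addRight]
  congr 2 <;> ring

lemma SS_parity (t : K) (k c h l m x y : ℤ) (hp : (y + c + h) % 2 ≠ 0) : SS t k c h l m x y = 0 := by
  unfold SS
  rw [← finsum_zero (M := K) (α := ℤ)]
  apply finsum_congr
  intro j
  rw [TT_zero, mul_zero]
  have e : 2 * (k - 1) * j = 2 * ((k - 1) * j) := by ring
  rw [e]
  omega

lemma SS_sub (t : K) (k : ℤ) (hk : 1 ≤ k) (c h l m c' h' l' m' x y : ℤ) :
    SS t k c h l m x y - SS t k c' h' l' m' x y =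
    ∑ᶠ j : ℤ, (t ^ (4 * k * j ^ 2 + l * j + m) * TT t x y (2 * k * j + c) (2 * (k - 1) * j + c - h)
     - t ^ (4 * k * j ^ 2 + l' * j + m') * TT t x y (2 * k * j + c') (2 * (k - 1) * j + c' - h')) := by
  unfold SS
  rw [finsum_sub_distrib]
  · exact SS_fin t k c x hk _ _ (fun _ => y)
  · exact SS_fin t k c' x hk _ _ (fun _ => y)

lemma insB_term (ht : Gen t) (x y : ℕ) (E α γ : ℤ) (h1 : ¬ (0 ≤ α ∧ α ≤ γ ∧ 0 < γ))
    (h2 : ¬ (α + 2 ≤ 0 ∧ γ ≤ α ∧ γ + 2 < 0)) :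
    t ^ E * TT t x (y + 1) α γ - t ^ (E + 4 * (α - γ)) * TT t x (y + 1) (α + 2) (γ + 2)
     = t ^ E * TT t x y α (γ + 1) - t ^ (E + 4 * (α - γ)) * TT t x y (α + 2) (γ + 1) := by
  by_cases hx : (x : ℤ) > y + 1
  · rw [TT_zero (by omega), TT_zero (by omega), TT_zero (by omega), TT_zero (by omega)]
  unfold TT
  have p1 := gh_pascal1 ht (N := y - 1 - γ) (m := x - α) (by omega)
  have p2 := gh_pascal1 ht (N := y + 1 + γ) (m := x + α + 2) (by omega)
  have hz : t ^ E * t ^ (2 * ((y : ℤ) - 1 - γ + 2 - (x - α))) =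
      t ^ (E + 4 * (α - γ)) * t ^ (2 * ((y : ℤ) + 1 + γ + 2 - (x + α + 2))) := by
    rw [← zpow_add₀ ht.1, ← zpow_add₀ ht.1]; congr 1; ring
  rw [show (y : ℤ) + 1 - γ = y - 1 - γ + 2 by ring, p1, show (y : ℤ) + 1 + (γ + 2) = y + 1 + γ + 2 by ring,
    show (x : ℤ) + (α + 2) = x + α + 2 by ring, p2, show (y : ℤ) + 1 - (γ + 2) = y - 1 - γ by ring,
    show (y : ℤ) + (γ + 1) = y + 1 + γ by ring, show (y : ℤ) - (γ + 1) = y - 1 - γ by ring,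
    show (x : ℤ) - (α + 2) = x - α - 2 by ring, show (x : ℤ) + α + 2 - 2 = x + α by ring]
  linear_combination (gh t (y + 1 + γ) (x + α) * gh t (y - 1 - γ) (x - α - 2)) * hz

lemma insA_term (ht : Gen t) (x y : ℕ) (E α γ : ℤ) (h1 : ¬ (α ≤ 0 ∧ γ ≤ α ∧ γ < 0))
    (h2 : ¬ (0 ≤ α - 2 ∧ α ≤ γ ∧ 0 < γ - 2)) :
    t ^ (-2 * (x : ℤ)) * (t ^ E * TT t x (y + 1) α γ - t ^ E * TT t x (y + 1) (α - 2) (γ - 2))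
     = t ^ (E + 2 * α) * TT t x y α (γ - 1) - t ^ (E - 2 * (α - 2)) * TT t x y (α - 2) (γ - 1) := by
  by_cases hx : (x : ℤ) > y + 1
  · rw [TT_zero (by omega), TT_zero (by omega), TT_zero (by omega), TT_zero (by omega)]; simp
  unfold TT
  have p1 := gh_pascal2 ht (N := y - 1 + γ) (m := x + α) (by omega)
  have p2 := gh_pascal2 ht (N := y + 1 - γ) (m := x - α + 2) (by omega)
  have hz1 : t ^ (-2 * (x : ℤ)) * t ^ E * t ^ (2 * ((x : ℤ) + α)) = t ^ (E + 2 * α) := by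
    rw [← zpow_add₀ ht.1, ← zpow_add₀ ht.1]; congr 1; ring
  have hz2 : t ^ (-2 * (x : ℤ)) * t ^ E * t ^ (2 * ((x : ℤ) - α + 2)) = t ^ (E - 2 * (α - 2)) := by
    rw [← zpow_add₀ ht.1, ← zpow_add₀ ht.1]; congr 1; ring
  rw [show (y : ℤ) + 1 + γ = y - 1 + γ + 2 by ring, p1, show (y : ℤ) + 1 - (γ - 2) = y + 1 - γ + 2 by ring,
    show (x : ℤ) - (α - 2) = x - α + 2 by ring, p2, show (y : ℤ) + 1 + (γ - 2) = y - 1 + γ by ring,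
    show (y : ℤ) + (γ - 1) = y - 1 + γ by ring, show (y : ℤ) - (γ - 1) = y + 1 - γ by ring,
    show (x : ℤ) + (α - 2) = x + α - 2 by ring, show (x : ℤ) - α + 2 - 2 = x - α by ring, ← hz1, ← hz2]
  ring

lemma insB (ht : Gen t) (k : ℤ) (hk : 1 ≤ k) (c h l m : ℤ) (h1 : -1 ≤ h) (h2 : h ≤ 1) (h3 : -2 < c)
    (h4 : c < 2 * k) (h5 : ¬ (0 ≤ c ∧ h ≤ 0 ∧ h < c)) (x y : ℕ) :
    SS t k c h l m x (y + 1) - SS t k (c + 2) h (l + 8) (m + 4 * h) x (y + 1)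
     = SS t k c (h - 1) l m x y - SS t k (c + 2) (h + 1) (l + 8) (m + 4 * h) x y := by
  rw [SS_sub t k hk, SS_sub t k hk]
  apply finsum_congr
  intro j
  have e := kj_cases k j hk
  have e1 : 2 * k * j = 2 * (k * j) := by ring
  have e2 : 2 * (k - 1) * j = 2 * (k * j) - 2 * j := by ring
  have := insB_term ht x y (4 * k * j ^ 2 + l * j + m) (2 * k * j + c) (2 * (k - 1) * j + c - h)
    (by rw [e1, e2]; omega) (by rw [e1, e2]; omega)
  convert this using 3
  · congr 1; ring
  · congr 1 <;> ring
  · congr 1; ring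
  · congr 1; ring
  · congr 1 <;> ring

lemma insA (ht : Gen t) (k : ℤ) (hk : 1 ≤ k) (c h l m : ℤ) (h1 : -1 ≤ h) (h2 : h ≤ 1) (h3 : -(2 * k) < c)
    (h4 : c < 2) (h5 : ¬ (c ≤ 0 ∧ 0 ≤ h ∧ c < h)) (x y : ℕ) :
    t ^ (-2 * (x : ℤ)) * (SS t k c h l m x (y + 1) - SS t k (c - 2) h l m x (y + 1))
     = SS t k c (h + 1) (l + 4 * k) (m + 2 * c) x y
       - SS t k (c - 2) (h - 1) (l - 4 * k) (m - 2 * (c - 2)) x y := by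
  rw [SS_sub t k hk, SS_sub t k hk, mul_finsum]
  · apply finsum_congr
    intro j
    have e := kj_cases k j hk
    have e1 : 2 * k * j = 2 * (k * j) := by ring
    have e2 : 2 * (k - 1) * j = 2 * (k * j) - 2 * j := by ring
    have := insA_term ht x y (4 * k * j ^ 2 + l * j + m) (2 * k * j + c) (2 * (k - 1) * j + c - h)
      (by rw [e1, e2]; omega) (by rw [e1, e2]; omega)
    convert this using 3
    · congr 2 <;> ring
    · congr 1; ring
    · congr 1; ring
    · congr 1; ring
    · congr 1 <;> ring

lemma SS_burge (ht : Gen t) (k : ℤ) (hk : 1 ≤ k) (c h l m : ℤ) (h1 : -1 ≤ h) (h2 : h ≤ 1)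
    (h3 : -(2 * k) ≤ c) (h4 : c ≤ 2 * k) (h5 : (0 ≤ c ∧ 0 ≤ h) ∨ (c ≤ 0 ∧ h ≤ 0)) (y z : ℕ) (z' : ℤ) (hz : z' = z) :
    ∑ x ∈ Finset.range (y + 3), t ^ (((y : ℤ) - x) ^ 2) * gh t (x + z') (2 * y) * SS t k c h l m x y
      = SS t (k + 1) (c + h) h (l + 4 * h) (m + h ^ 2) y z' := by
  unfold SS
  rw [Finset.sum_congr rfl (fun x _ => mul_finsum _ _),
    ← finsum_sum_comm]
  · apply finsum_congr
    intro j
    have e := kj_cases k j hk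
    have e1 : 2 * k * j = 2 * (k * j) := by ring
    have e2 : 2 * (k - 1) * j = 2 * (k * j) - 2 * j := by ring
    have := burge ht y z z' hz (2 * k * j + c) (2 * (k - 1) * j + c - h) (by rw [e1, e2]; omega)
    rw [Finset.sum_congr rfl (fun x _ => mul_left_comm _ _ _), ← Finset.mul_sum, this, ← mul_assoc,
      ← zpow_add₀ ht.1]
    congr 2 <;> ring
  · intro x _
    apply (SS_fin t k c x hk (fun j => (t ^ (((y : ℤ) - x) ^ 2) * gh t (x + z') (2 * y)) * t ^ (4 * k * j ^ 2 + l * j + m))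
      _ (fun _ => (y : ℤ))).subset
    intro j hj
    simpa only [Function.mem_support, mul_assoc] using hj

lemma SS_last (ht : Gen t) (k : ℤ) (hk : 1 ≤ k) (c h l m : ℤ) (h1 : -1 ≤ h) (h2 : h ≤ 1)
    (h3 : -(2 * k) ≤ c) (h4 : c ≤ 2 * k) (h5 : (0 ≤ c ∧ 0 ≤ h) ∨ (c ≤ 0 ∧ h ≤ 0)) (y : ℕ) :
    ∑ x ∈ Finset.range (y + 3), t ^ ((x : ℤ) ^ 2) * SS t k c h l m x y
      = ∑ᶠ j : ℤ, t ^ (4 * k * j ^ 2 + l * j + m + (2 * k * j + c) ^ 2)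
        * gh t (2 * y) (y + 2 * (k + 1) * j + c + h) := by
  unfold SS
  rw [Finset.sum_congr rfl (fun x _ => mul_finsum _ _),
    ← finsum_sum_comm]
  · apply finsum_congr
    intro j
    have e := kj_cases k j hk
    have e1 : 2 * k * j = 2 * (k * j) := by ring
    have e2 : 2 * (k - 1) * j = 2 * (k * j) - 2 * j := by ring
    have := lastStep ht y (2 * k * j + c) (2 * (k - 1) * j + c - h) (by rw [e1, e2]; omega)
    rw [Finset.sum_congr rfl (fun x _ => mul_left_comm _ _ _), ← Finset.mul_sum, this, ← mul_assoc,
      ← zpow_add₀ ht.1]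
    congr 2; ring
  · intro x _
    apply (SS_fin t k c x hk (fun j => t ^ ((x : ℤ) ^ 2) * t ^ (4 * k * j ^ 2 + l * j + m))
      _ (fun _ => (y : ℤ))).subset
    intro j hj
    simpa only [Function.mem_support, mul_assoc] using hj

/-- the four bosonic phases -/
def bV (t : K) (k x y : ℤ) : K := SS t k 0 0 (-4) 0 x y - SS t k 2 0 4 0 x y

def bB (t : K) (k s x y : ℤ) : K :=
  SS t k (-s) (-1) (-4 * (s + 1)) s x y - SS t k (2 + s) 1 (4 * (s + 1)) s x y

def bA (t : K) (k s x y : ℤ) : K :=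
  SS t k s 1 (4 * (k - 1)) s x y - SS t k (2 + s) 1 (4 * (k + 1)) (4 + s) x y

def bAB (t : K) (k a b x y : ℤ) : K :=
  SS t k (b - a) 0 (4 * b) (b - a) x y - SS t k (a + b) 0 (4 * b) (b - a) x y

lemma SS_cong (t : K) (k x y : ℤ) {c c' h h' l l' m m' : ℤ} (e1 : c = c') (e2 : h = h') (e3 : l = l')
    (e4 : m = m') : SS t k c h l m x y = SS t k c' h' l' m' x y := by
  subst e1 e2 e3 e4; rfl

lemma bV_burge (ht : Gen t) (k : ℤ) (hk : 1 ≤ k) (y z : ℕ) (z' : ℤ) (hz : z' = z) :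
    ∑ x ∈ Finset.range (y + 3), t ^ (((y : ℤ) - x) ^ 2) * gh t (x + z') (2 * y) * bV t k x y
      = bV t (k + 1) y z' := by
  unfold bV
  simp only [mul_sub, Finset.sum_sub_distrib]
  rw [SS_burge ht k hk _ _ _ _ (by omega) (by omega) (by omega) (by omega) (by omega) y z z' hz,
    SS_burge ht k hk _ _ _ _ (by omega) (by omega) (by omega) (by omega) (by omega) y z z' hz]
  congr 1

lemma bB_burge (ht : Gen t) (k : ℤ) (hk : 1 ≤ k) (s : ℤ) (hs : 0 ≤ s) (hs' : 2 + s ≤ 2 * k) (y z : ℕ) (z' : ℤ) (hz : z' = z) :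
    ∑ x ∈ Finset.range (y + 3), t ^ (((y : ℤ) - x) ^ 2) * gh t (x + z') (2 * y) * bB t k s x y
      = bB t (k + 1) (s + 1) y z' := by
  unfold bB
  simp only [mul_sub, Finset.sum_sub_distrib]
  rw [SS_burge ht k hk _ _ _ _ (by omega) (by omega) (by omega) (by omega) (by omega) y z z' hz,
    SS_burge ht k hk _ _ _ _ (by omega) (by omega) (by omega) (by omega) (by omega) y z z' hz]
  congr 1 <;> apply SS_cong <;> ring

lemma bA_burge (ht : Gen t) (k : ℤ) (hk : 1 ≤ k) (s : ℤ) (hs : 0 ≤ s) (hs' : 2 + s ≤ 2 * k) (y z : ℕ) (z' : ℤ) (hz : z' = z) :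
    ∑ x ∈ Finset.range (y + 3), t ^ (((y : ℤ) - x) ^ 2) * gh t (x + z') (2 * y) * bA t k s x y
      = bA t (k + 1) (s + 1) y z' := by
  unfold bA
  simp only [mul_sub, Finset.sum_sub_distrib]
  rw [← Finset.sum_sub_distrib]
  simp only [← mul_sub]
  simp only [mul_sub (_ * _), Finset.sum_sub_distrib]
  rw [SS_burge ht k hk _ _ _ _ (by omega) (by omega) (by omega) (by omega) (by omega) y z z' hz,
    SS_burge ht k hk _ _ _ _ (by omega) (by omega) (by omega) (by omega) (by omega) y z z' hz]
  congr 1 <;> apply SS_cong <;> ring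

lemma bAB_burge (ht : Gen t) (k : ℤ) (hk : 1 ≤ k) (a b : ℤ) (ha : 0 ≤ a) (hb : 0 ≤ b) (ha' : a ≤ k) (hb' : b ≤ k)
    (y z : ℕ) (z' : ℤ) (hz : z' = z) :
    ∑ x ∈ Finset.range (y + 3), t ^ (((y : ℤ) - x) ^ 2) * gh t (x + z') (2 * y) * bAB t k a b x y
      = bAB t (k + 1) a b y z' := by
  unfold bAB
  simp only [mul_sub (_ * _), Finset.sum_sub_distrib]
  rw [SS_burge ht k hk _ _ _ _ (by omega) (by omega) (by omega) (by omega) (by omega) y z z' hz,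
    SS_burge ht k hk _ _ _ _ (by omega) (by omega) (by omega) (by omega) (by omega) y z z' hz]
  congr 1 <;> apply SS_cong <;> ring

lemma bV_insB (ht : Gen t) (k : ℤ) (hk : 1 ≤ k) (x y : ℕ) : bV t k x (y + 1) = bB t k 0 x y := by
  have := insB ht k hk 0 0 (-4) 0 (by omega) (by omega) (by omega) (by omega) (by omega) x y
  unfold bV bB
  exact this

lemma bV_insA (ht : Gen t) (k : ℤ) (hk : 1 ≤ k) (x y : ℕ) :
    t ^ (-2 * (x : ℤ)) * bV t k x (y + 1) = bA t k 0 x y := by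
  have := insA ht k hk 0 0 (-4) 0 (by omega) (by omega) (by omega) (by omega) (by omega) x y
  unfold bV bA
  rw [SS_reflect t k 2, SS_reflect t k (2 + 0)]
  convert this using 2
  · congr 1
  · apply SS_cong <;> ring
  · apply SS_cong <;> ring

lemma bA_insB (ht : Gen t) (k a b : ℤ) (hk : 1 ≤ k) (hb : k = b + 1) (ha : 0 ≤ a) (hab : a ≤ b) (x y : ℕ) :
    bA t k (b - a) x (y + 1) = bAB t k a b x y := by
  have := insB ht k hk (b - a) 1 (4 * (k - 1)) (b - a) (by omega) (by omega) (by omega) (by omega) (by omega) x y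
  unfold bA bAB
  rw [SS_reflect t k (a + b), SS_shift t k (-(a + b))]
  subst hb
  convert this using 2 <;> apply SS_cong <;> ring

lemma bB_insA (ht : Gen t) (k a b : ℤ) (hk : 1 ≤ k) (hb : k = a + 1) (ha : 0 ≤ b) (hab : b ≤ a) (x y : ℕ) :
    t ^ (-2 * (x : ℤ)) * bB t k (a - b) x (y + 1) = bAB t k a b x y := by
  have := insA ht k hk (-(a - b)) (-1) (-4 * (a - b + 1)) (a - b) (by omega) (by omega) (by omega) (by omega) (by omega) x y
  unfold bB bAB
  rw [SS_reflect t k (a + b), SS_shift t k (-(a + b)), SS_reflect t k (2 + (a - b)), SS_reflect t k (-(a + b) + 2 * k)]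
  subst hb
  convert this using 2
  · congr 1; apply SS_cong <;> ring
  · apply SS_cong <;> ring
  · apply SS_cong <;> ring

lemma bV_one (ht : Gen t) (x y : ℕ) : bV t 1 x y = if y = 0 ∧ x = 0 then 1 else 0 := by
  rcases y with _ | y
  · unfold bV SS
    have e2 : ∀ j : ℤ, t ^ (4 * 1 * j ^ 2 + 4 * j + 0) * TT t x (0 : ℕ) (2 * 1 * j + 2) (2 * (1 - 1) * j + 2 - 0) = 0 := by
      intro j
      rw [TT_zero (by omega), mul_zero]
    rw [finsum_congr e2, finsum_zero, sub_zero, finsum_eq_single _ 0]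
    · by_cases hx : x = 0
      · subst hx
        have : gh t 0 0 = 1 := by
          have := gh_two t 0 0
          simp only [mul_zero] at this
          rw [this, gauss_self ht le_rfl]
        simp [TT, this]
      · rw [TT_zero (by omega)]; simp [hx]
    · intro j hj
      rw [TT_zero (by omega), mul_zero]
  · push_cast
    rw [bV_insB ht 1 le_rfl]
    unfold bB
    rw [SS_shift t 1 (-0)]
    simp

lemma bV_two (ht : Gen t) (x y : ℕ) : bV t 2 x y = if x = 0 ∧ y % 2 = 0 then 1 else 0 := by
  rw [show (2 : ℤ) = 1 + 1 by norm_num, ← bV_burge ht 1 le_rfl x y y rfl]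
  simp only [bV_one ht]
  by_cases hx : x = 0
  · subst hx
    rw [Finset.sum_eq_single 0]
    · by_cases hy : y % 2 = 0
      · obtain ⟨n, rfl⟩ : ∃ n, y = 2 * n := ⟨y / 2, by omega⟩
        have := gh_two t n 0
        rw [gauss_zero_right ht (by omega)] at this
        simp at this
        simp [this]
      · rw [gh_zero t (by omega)]; simp [hy]
    · intro b _ hb; simp [hb]
    · simp
  · simp [hx]

/-- phases combined -/
def ph (t : K) (a b : ℕ) (k : ℤ) (p q : Prop) (x y : ℤ) : K :=
  if p then (if q then bAB t k a b x y else bA t k (k - 1 - a) x y)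
  else (if q then bB t k (k - 1 - b) x y else bV t k x y)

lemma ph_burge (ht : Gen t) (a b k : ℕ) (y z : ℕ) (z' : ℤ) (hz : z' = z) :
    ∑ x ∈ Finset.range (y + 3), t ^ (((y : ℤ) - x) ^ 2) * gh t (x + z') (2 * y)
        * ph t a b (k + 2) (a ≤ k + 1) (b ≤ k + 1) x y
      = ph t a b (k + 3) (a ≤ k + 1) (b ≤ k + 1) y z' := by
  unfold ph
  rw [show (k : ℤ) + 3 = k + 2 + 1 by ring]
  split_ifs with h1 h2 h2
  · exact bAB_burge ht _ (by omega) a b (by omega) (by omega) (by omega) (by omega) y z z' hz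
  · rw [bA_burge ht _ (by omega) _ (by omega) (by omega) y z z' hz]; congr 1; ring
  · rw [bB_burge ht _ (by omega) _ (by omega) (by omega) y z z' hz]; congr 1; ring
  · exact bV_burge ht _ (by omega) y z z' hz

/-- insertion indicator -/
def dl (a k : ℕ) : ℕ := if a = k + 1 then 1 else 0

lemma ph_ins (ht : Gen t) (a b k x y : ℕ) :
    t ^ (-2 * (x : ℤ) * dl a k) * ph t a b (k + 2) (a ≤ k) (b ≤ k) x (y + dl a k + dl b k)
      = ph t a b (k + 2) (a ≤ k + 1) (b ≤ k + 1) x y := by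
  unfold ph dl
  by_cases ha : a = k + 1 <;> by_cases hb : b = k + 1
  · have e := bB_insA ht (k + 2) a b (by omega) (by omega) (by omega) (by omega) x y
    rw [show (a : ℤ) - b = 0 by omega] at e
    have e2 := bV_insB ht (k + 2) (by omega) x (y + 1)
    push_cast at e2
    rw [← e2] at e
    rw [if_pos ha, if_pos hb, if_neg (by omega), if_neg (by omega), if_pos (by omega), if_pos (by omega)]
    simpa using e
  · by_cases hb2 : b ≤ k
    · have e := bB_insA ht (k + 2) a b (by omega) (by omega) (by omega) (by omega) x y
      rw [if_pos ha, if_neg hb, if_neg (by omega), if_pos (by omega), if_pos (by omega), if_pos (by omega),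
        show (k : ℤ) + 2 - 1 - b = a - b by omega]
      simpa using e
    · have e := bV_insA ht (k + 2) (by omega) x y
      rw [if_pos ha, if_neg hb, if_neg (by omega), if_neg (by omega), if_pos (by omega), if_neg (by omega),
        show (k : ℤ) + 2 - 1 - a = 0 by omega]
      simpa using e
  · by_cases ha2 : a ≤ k
    · have e := bA_insB ht (k + 2) a b (by omega) (by omega) (by omega) (by omega) x y
      rw [if_neg ha, if_pos hb, if_pos (by omega), if_neg (by omega), if_pos (by omega), if_pos (by omega),
        show (k : ℤ) + 2 - 1 - a = b - a by omega]
      simpa using e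
    · have e := bV_insB ht (k + 2) (by omega) x y
      rw [if_neg ha, if_pos hb, if_neg (by omega), if_neg (by omega), if_neg (by omega), if_pos (by omega),
        show (k : ℤ) + 2 - 1 - b = 0 by omega]
      simpa using e
  · have e1 : (a ≤ k) = (a ≤ k + 1) := by apply propext; omega
    have e2 : (b ≤ k) = (b ≤ k + 1) := by apply propext; omega
    simp [ha, hb, e1, e2]
    split_ifs <;> rfl

/-- the parity vector by position -/
def QQ (a b k : ℕ) : ℕ := min (a - 1) k + min (b - 1) k

lemma ph_parity (a b k x y : ℕ) (ha : 1 ≤ a) (hb : 1 ≤ b) (h : ¬ y % 2 = QQ a b (k + 1) % 2) :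
    ph t a b (k + 2) (a ≤ k + 1) (b ≤ k + 1) x y = 0 := by
  unfold ph
  unfold QQ at h
  split_ifs with h1 h2 h2
  · unfold bAB; rw [SS_parity _ _ _ _ _ _ _ _ (by omega), SS_parity _ _ _ _ _ _ _ _ (by omega), sub_zero]
  · unfold bA; rw [SS_parity _ _ _ _ _ _ _ _ (by omega), SS_parity _ _ _ _ _ _ _ _ (by omega), sub_zero]
  · unfold bB; rw [SS_parity _ _ _ _ _ _ _ _ (by omega), SS_parity _ _ _ _ _ _ _ _ (by omega), sub_zero]
  · unfold bV; rw [SS_parity _ _ _ _ _ _ _ _ (by omega), SS_parity _ _ _ _ _ _ _ _ (by omega), sub_zero]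

/-- the fermionic recursion -/
def RR (t : K) (a b : ℕ) : ℕ → ℕ → ℕ → K
  | 0, _, x => if x = 0 then 1 else 0
  | k + 1, z, y => if y % 2 = QQ a b (k + 1) % 2 then
      ∑ x ∈ Finset.range (y + 3), t ^ (((y : ℤ) - x) ^ 2) * t ^ (-2 * (y : ℤ) * dl a (k + 1))
        * gaussHalf t (z + x + dl a (k + 1) + dl b (k + 1)) y * RR t a b k y x
      else 0

lemma RR_eq (ht : Gen t) (a b : ℕ) (ha : 1 ≤ a) (hb : 1 ≤ b) (k : ℕ) : ∀ x y : ℕ,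
    (if y % 2 = QQ a b (k + 1) % 2 then RR t a b k y x else 0)
      = ph t a b (k + 2) (a ≤ k + 1) (b ≤ k + 1) x y := by
  induction k with
  | zero =>
    intro x y
    rw [← ph_ins ht]
    have e : ph t a b ((0 : ℕ) + 2) (a ≤ 0) (b ≤ 0) x (y + dl a 0 + dl b 0) = bV t 2 x (y + dl a 0 + dl b 0 : ℕ) := by
      unfold ph
      rw [if_neg (by omega), if_neg (by omega)]
      push_cast; norm_num
    rw [e, bV_two ht]
    by_cases hx : x = 0
    · have : (y % 2 = QQ a b (0 + 1) % 2) ↔ ((y + dl a 0 + dl b 0) % 2 = 0) := by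
        unfold QQ dl; split_ifs <;> omega
      simp [hx, RR, this]
    · simp [hx, RR]
  | succ k ih =>
    intro x y
    by_cases hp : y % 2 = QQ a b (k + 1 + 1) % 2
    · rw [if_pos hp, ← ph_ins ht]
      have e := ph_burge ht a b k x (y + dl a (k + 1) + dl b (k + 1)) _ rfl
      push_cast
      rw [show (k : ℤ) + 1 + 2 = k + 3 by ring]
      push_cast at e
      rw [← e, RR, Finset.mul_sum]
      by_cases hq : x % 2 = QQ a b (k + 1) % 2
      · rw [if_pos hq]
        apply Finset.sum_congr rfl
        intro w _
        have := ih w x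
        rw [if_pos hq] at this
        rw [this, gaussHalf_eq, show (y : ℤ) + w + dl a (k + 1) + dl b (k + 1) = w + (y + dl a (k + 1) + dl b (k + 1)) by ring]
        ring
      · rw [if_neg hq]
        symm
        apply Finset.sum_eq_zero
        intro w _
        rw [ph_parity a b k w x ha hb hq, mul_zero, mul_zero]
    · rw [if_neg hp]
      symm
      exact ph_parity a b (k + 1) x y ha hb hp

/-- first component -/
def hd : (d : ℕ) → (Fin d → ℕ) → ℕ
  | 0, _ => 0
  | _ + 1, m => m 0

def topp (d a b L : ℕ) (m : Fin d → ℕ) (i : Fin d) : ℤ :=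
  (∑ k, inc d i k * (m k : ℤ)) + (L : ℤ) * uv d 1 i + uv d ((d : ℤ) + 2 - a) i + uv d ((d : ℤ) + 2 - b) i

def FT (d a b L : ℕ) (t : K) (m : Fin d → ℕ) : K :=
  t ^ (quadC d m - 2 * mAt d m ((d : ℤ) + 2 - a)) * ∏ i, gaussHalf t (topp d a b L m i) (m i)

def parr (d a b : ℕ) (m : Fin d → ℕ) : Prop := ∀ i : Fin d, m i % 2 = QQ a b (d - i) % 2

def WW (d a b L : ℕ) (t : K) (m : Fin d → ℕ) : K := if parr d a b m then FT d a b L t m else 0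

lemma sum_first (d : ℕ) (m : Fin d → ℕ) :
    ∑ k : Fin d, (if (k : ℕ) = 0 then (1 : ℤ) else 0) * (m k : ℤ) = hd d m := by
  cases d with
  | zero => simp [hd]
  | succ d => rw [Fin.sum_univ_succ]; simp [hd]

lemma inc_zero_zero (d : ℕ) : inc (d + 1) 0 0 = 0 := by simp [inc]
lemma inc_zero_succ (d : ℕ) (k : Fin d) : inc (d + 1) 0 k.succ = if (k : ℕ) = 0 then 1 else 0 := by
  simp only [inc, Fin.val_zero, Fin.val_succ]
  congr 1
  apply propext; omega
lemma inc_succ_zero (d : ℕ) (k : Fin d) : inc (d + 1) k.succ 0 = if (k : ℕ) = 0 then 1 else 0 := by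
  simp only [inc, Fin.val_zero, Fin.val_succ]
  congr 1
  apply propext; omega
lemma inc_succ_succ (d : ℕ) (i k : Fin d) : inc (d + 1) i.succ k.succ = inc d i k := by
  simp only [inc, Fin.val_succ]
  congr 1
  apply propext; omega
lemma uv_zero (d : ℕ) (s : ℤ) : uv (d + 1) s 0 = if s = 1 then 1 else 0 := by
  simp only [uv, Fin.val_zero]
  congr 1
  apply propext; omega
lemma uv_succ (d : ℕ) (s : ℤ) (i : Fin d) : uv (d + 1) s i.succ = uv d (s - 1) i := by
  simp only [uv, Fin.val_succ]
  congr 1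
  apply propext; omega
lemma uv_one (d : ℕ) (i : Fin d) : uv d 1 i = if (i : ℕ) = 0 then 1 else 0 := by
  simp only [uv]
  congr 1
  apply propext; omega
lemma uv_nul (d : ℕ) (i : Fin d) : uv d 0 i = 0 := by
  simp only [uv]
  rw [if_neg (by omega)]

lemma uv_dl (d a : ℕ) : uv (d + 1) (((d + 1 : ℕ) : ℤ) + 2 - a) 0 = dl a (d + 1) := by
  rw [uv_zero]; unfold dl
  by_cases h : a = d + 1 + 1
  · rw [if_pos h, if_pos (by omega)]; rfl
  · rw [if_neg h, if_neg (by omega)]; rfl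

lemma topp_zero (d a b L y : ℕ) (m : Fin d → ℕ) :
    topp (d + 1) a b L (Fin.cons y m) 0 = L + hd d m + dl a (d + 1) + dl b (d + 1) := by
  unfold topp
  rw [Fin.sum_univ_succ, uv_dl, uv_dl]
  simp only [inc_zero_zero, inc_zero_succ, Fin.cons_succ, sum_first, uv_zero]
  simp
  ring

lemma topp_succ (d a b L y : ℕ) (m : Fin d → ℕ) (i : Fin d) :
    topp (d + 1) a b L (Fin.cons y m) i.succ = topp d a b y m i := by
  unfold topp
  rw [Fin.sum_univ_succ]
  simp only [inc_succ_zero, inc_succ_succ, Fin.cons_succ, Fin.cons_zero, uv_succ, uv_one, sub_self, uv_nul]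
  rw [show ((d + 1 : ℕ) : ℤ) + 2 - a - 1 = d + 2 - a by push_cast; ring,
    show ((d + 1 : ℕ) : ℤ) + 2 - b - 1 = d + 2 - b by push_cast; ring]
  ring

lemma mAt_cons (d a y : ℕ) (m : Fin d → ℕ) :
    mAt (d + 1) (Fin.cons y m) (((d + 1 : ℕ) : ℤ) + 2 - a) = dl a (d + 1) * y + mAt d m ((d : ℤ) + 2 - a) := by
  unfold mAt
  rw [Fin.sum_univ_succ, uv_dl]
  simp only [Fin.cons_succ, Fin.cons_zero, uv_succ]
  rw [show ((d + 1 : ℕ) : ℤ) + 2 - a - 1 = d + 2 - a by push_cast; ring]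

lemma quadC_cons (d y : ℕ) (m : Fin d → ℕ) :
    quadC (d + 1) (Fin.cons y m) = 2 * y ^ 2 - 2 * y * hd d m + quadC d m := by
  unfold quadC
  rw [Fin.sum_univ_succ]
  simp only [Fin.sum_univ_succ, Fin.cons_succ, Fin.cons_zero, cartan, inc_zero_zero, inc_zero_succ, inc_succ_zero,
    inc_succ_succ, Finset.sum_add_distrib, Fin.succ_inj]
  rw [← sum_first]
  simp only [if_neg (Fin.succ_ne_zero _), if_neg (Fin.succ_ne_zero _).symm]
  have e1 : ∑ x : Fin d, (y : ℤ) * (0 - if (x : ℕ) = 0 then 1 else 0) * (m x : ℤ) =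
     - y * ∑ k : Fin d, (if (k : ℕ) = 0 then (1 : ℤ) else 0) * (m k : ℤ) := by
    rw [Finset.mul_sum]; apply Finset.sum_congr rfl; intros; ring
  have e2 : ∑ x : Fin d, (m x : ℤ) * (0 - if (x : ℕ) = 0 then 1 else 0) * y =
     - y * ∑ k : Fin d, (if (k : ℕ) = 0 then (1 : ℤ) else 0) * (m k : ℤ) := by
    rw [Finset.mul_sum]; apply Finset.sum_congr rfl; intros; ring
  rw [e1, e2]
  simp only [if_true]
  ring

lemma parr_cons (d a b y : ℕ) (m : Fin d → ℕ) :
    parr (d + 1) a b (Fin.cons y m) ↔ y % 2 = QQ a b (d + 1) % 2 ∧ parr d a b m := by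
  unfold parr
  rw [Fin.forall_fin_succ]
  simp

def cc (d a b L : ℕ) (t : K) (y x : ℕ) : K :=
  if y % 2 = QQ a b (d + 1) % 2 then
    t ^ (2 * (y : ℤ) ^ 2 - 2 * y * x - 2 * (dl a (d + 1) * y)) * gaussHalf t (L + x + dl a (d + 1) + dl b (d + 1)) y
  else 0

lemma WW_cons (ht : Gen t) (d a b L y : ℕ) (m : Fin d → ℕ) :
    WW (d + 1) a b L t (Fin.cons y m) = cc d a b L t y (hd d m) * WW d a b y t m := by
  unfold WW cc
  rw [if_congr (parr_cons d a b y m) rfl rfl]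
  by_cases h1 : y % 2 = QQ a b (d + 1) % 2 <;> by_cases h2 : parr d a b m
  · rw [if_pos ⟨h1, h2⟩, if_pos h1, if_pos h2]
    unfold FT
    rw [Fin.prod_univ_succ, topp_zero, mAt_cons, quadC_cons]
    simp only [topp_succ, Fin.cons_succ, Fin.cons_zero]
    rw [show 2 * (y : ℤ) ^ 2 - 2 * y * hd d m + quadC d m - 2 * (dl a (d + 1) * y + mAt d m ((d : ℤ) + 2 - a))
      = (2 * (y : ℤ) ^ 2 - 2 * y * hd d m - 2 * (dl a (d + 1) * y)) + (quadC d m - 2 * mAt d m ((d : ℤ) + 2 - a)) by ring,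
      zpow_add₀ ht.1]
    ring
  · simp [h1, h2]
  · simp [h1, h2]
  · simp [h1, h2]

lemma WW_bound (ht : Gen t) (a b d : ℕ) : ∀ (L : ℕ) (m : Fin d → ℕ), WW d a b L t m ≠ 0 →
    hd d m ≤ L + (if a ≤ d + 1 then 1 else 0) + (if b ≤ d + 1 then 1 else 0) := by
  induction d with
  | zero => intro L m _; simp [hd]
  | succ d ih =>
    intro L m
    obtain ⟨y, m, rfl⟩ : ∃ y m', m = Fin.cons y m' := ⟨m 0, Fin.tail m, (Fin.cons_self_tail m).symm⟩
    intro h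
    rw [WW_cons ht] at h
    have h1 := ih y m (right_ne_zero_of_mul h)
    have h2 := left_ne_zero_of_mul h
    unfold cc at h2
    split_ifs at h2
    · have h3 := right_ne_zero_of_mul h2
      rw [gaussHalf_eq] at h3
      have h4 := gh_ne h3
      have : hd (d + 1) (Fin.cons y m) = y := rfl
      rw [this]
      unfold dl at h4
      split_ifs at * <;> omega
    · exact absurd rfl h2

lemma WW_lt (ht : Gen t) (a b d L : ℕ) (m : Fin d → ℕ) (h : WW d a b L t m ≠ 0) : hd d m < L + 3 := by
  have := WW_bound ht a b d L m h
  split_ifs at this <;> omega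

lemma WW_fin (ht : Gen t) (a b d : ℕ) : ∀ L : ℕ, (Function.support (WW d a b L t)).Finite := by
  induction d with
  | zero => intro L; exact Set.toFinite _
  | succ d ih =>
    intro L
    apply Set.Finite.subset (Set.Finite.biUnion (Set.finite_Iio (L + 3))
      (fun y _ => (ih y).image (fun m => (Fin.cons y m : Fin (d + 1) → ℕ))))
    intro m
    obtain ⟨y, m, rfl⟩ : ∃ y m', m = Fin.cons y m' := ⟨m 0, Fin.tail m, (Fin.cons_self_tail m).symm⟩
    intro h
    have h0 : WW (d + 1) a b L t (Fin.cons y m) ≠ 0 := h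
    have h1 : y < L + 3 := WW_lt ht _ _ _ _ _ h0
    rw [WW_cons ht] at h0
    simp only [Set.mem_iUnion]
    exact ⟨y, h1, m, right_ne_zero_of_mul h0, rfl⟩

lemma WW_sum (ht : Gen t) (a b d : ℕ) : ∀ (L : ℕ) (G : ℕ → K),
    ∑ᶠ m : Fin d → ℕ, G (hd d m) * WW d a b L t m
      = ∑ x ∈ Finset.range (L + 3), G x * t ^ ((x : ℤ) ^ 2) * RR t a b d L x := by
  induction d with
  | zero =>
    intro L G
    rw [finsum_eq_single _ (fun i : Fin 0 => i.elim0) (fun m hm => absurd (Subsingleton.elim _ _) hm),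
      Finset.sum_eq_single 0]
    · simp [hd, WW, parr, FT, quadC, mAt, RR]
    · intro x _ hx; simp [RR, hx]
    · simp
  | succ d ih =>
    intro L G
    have hf : (Function.support (fun m : Fin (d + 1) → ℕ => G (hd (d + 1) m) * WW (d + 1) a b L t m)).Finite :=
      (WW_fin ht a b (d + 1) L).subset (fun m hm => right_ne_zero_of_mul hm)
    have e0 : ∀ p : ℕ × (Fin d → ℕ), (Fin.consEquiv (fun _ : Fin (d + 1) => ℕ)) p = Fin.cons p.1 p.2 := fun p => rfl
    rw [← finsum_comp_equiv (Fin.consEquiv (fun _ : Fin (d + 1) => ℕ)), finsum_curry]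
    · rw [finsum_eq_sum_of_support_subset (s := Finset.range (L + 3))]
      · apply Finset.sum_congr rfl
        intro y _
        have e1 : ∀ m : Fin d → ℕ, G (hd (d + 1) (Fin.consEquiv (fun _ : Fin (d + 1) => ℕ) (y, m)))
            * WW (d + 1) a b L t (Fin.consEquiv (fun _ : Fin (d + 1) => ℕ) (y, m)) =
            (fun x => G y * cc d a b L t y x) (hd d m) * WW d a b y t m := by
          intro m
          rw [e0, WW_cons ht, ← mul_assoc]; rfl
        rw [finsum_congr e1, ih y (fun x => G y * cc d a b L t y x), RR]
        unfold cc
        by_cases h : y % 2 = QQ a b (d + 1) % 2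
        · simp only [if_pos h]
          rw [Finset.mul_sum]
          apply Finset.sum_congr rfl
          intro x _
          have : t ^ (2 * (y : ℤ) ^ 2 - 2 * y * x - 2 * (dl a (d + 1) * y)) * t ^ ((x : ℤ) ^ 2) =
            t ^ ((y : ℤ) ^ 2) * (t ^ (((y : ℤ) - x) ^ 2) * t ^ (-2 * (y : ℤ) * dl a (d + 1))) := by
            rw [← zpow_add₀ ht.1, ← zpow_add₀ ht.1, ← zpow_add₀ ht.1]; congr 1; ring
          linear_combination (G y * gaussHalf t (L + x + dl a (d + 1) + dl b (d + 1)) y * RR t a b d y x) * this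
        · simp [if_neg h]
      · intro y hy
        by_contra hy2
        apply hy
        rw [← finsum_zero (M := K) (α := Fin d → ℕ)]
        apply finsum_congr
        intro m
        by_contra hm
        have : y < L + 3 := WW_lt ht _ _ _ _ _ (right_ne_zero_of_mul hm)
        apply hy2
        simpa using this
    · apply (hf.preimage (Fin.consEquiv (fun _ : Fin (d + 1) => ℕ)).injective.injOn).subset
      intro p hp; exact hp

lemma fermSum_eq (ht : Gen t) (a b d L : ℕ) :
    fermSum (d + 3) a b L t = ∑ x ∈ Finset.range (L + 3), t ^ ((x : ℤ) ^ 2) * RR t a b d L x := by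
  have := WW_sum ht a b d L (fun _ => 1)
  simp only [one_mul] at this
  rw [← this]
  unfold fermSum
  apply finsum_congr
  intro m
  unfold WW
  have e : ∀ c : ℕ, ((d + 3 : ℕ) : ℤ) - c - 1 = d + 2 - c := by intro c; push_cast; ring
  have e1 : parity (d + 3) a b m ↔ parr d a b m := by
    unfold parity parr
    apply forall_congr'
    intro i
    have : Qab (d + 3) a b i = QQ a b (d - i) := by
      unfold Qab QQ
      have : (d + 3) - ((i : ℕ) + 1) - 2 = d - i := by omega
      rw [this]
    rw [this]
  rw [if_congr e1 rfl rfl]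
  congr 1
  unfold fermTerm FT topE topp
  rw [e, e]
  rfl

lemma gauss_fin (t : K) (L A r : ℤ) (hr : 1 ≤ r) (f : ℤ → K) :
    (Function.support fun j : ℤ => f j * gauss t L (A - r * j)).Finite := by
  apply (Set.finite_Icc (-(|L| + |A|)) (|L| + |A|)).subset
  intro j hj
  have h : 0 ≤ A - r * j ∧ A - r * j ≤ L := by
    by_contra h
    exact right_ne_zero_of_mul hj (gauss_zero_of t h)
  have hc := abs_le.1 (le_refl |A|)
  have hl := abs_le.1 (le_refl |L|)
  have := kj_cases r j hr
  simp only [Set.mem_Icc]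
  omega

lemma final_one (ht : Gen t) (k : ℤ) (hk : 1 ≤ k) (c h l m : ℤ) (h1 : -1 ≤ h) (h2 : h ≤ 1)
    (h3 : -(2 * k) ≤ c) (h4 : c ≤ 2 * k) (h5 : (0 ≤ c ∧ 0 ≤ h) ∨ (c ≤ 0 ∧ h ≤ 0)) (L : ℕ)
    (hp : ((L : ℤ) + c + h) % 2 = 0) (f B : ℤ) (P : ℤ → ℤ) (hB : B = L - c - h)
    (hP : ∀ j, 4 * k * j ^ 2 + l * j + m + (2 * k * j + c) ^ 2 = f + P j) :
    ∑ x ∈ Finset.range (L + 3), t ^ ((x : ℤ) ^ 2) * SS t k c h l m x L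
      = t ^ f * ∑ᶠ j : ℤ, t ^ (P j) * gauss t L (B / 2 - (k + 1) * j) := by
  rw [SS_last ht k hk c h l m h1 h2 h3 h4 h5, mul_finsum]
  apply finsum_congr
  intro j
  rw [hP, zpow_add₀ ht.1, mul_assoc, ← gauss_symm, ← gh_two]
  congr 3
  rw [hB]
  have : 2 * (k + 1) * j = 2 * ((k + 1) * j) := by ring
  rw [this]
  omega

lemma melzer_gen (ht : Gen t) (d a b L : ℕ) (ha : 1 ≤ a) (ha' : a ≤ d + 2)
    (hb : 1 ≤ b) (hb' : b ≤ d + 1) (hL : ((L : ℤ) - a - b) % 2 = 0) (r : ℤ) (hr : r = d + 3) :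
    t ^ (-(((a : ℤ) - b) * ((a : ℤ) - b - 1))) * fermSum (d + 3) a b L t
      = ∑ᶠ j : ℤ,
          (t ^ (4 * (j * (r * (r - 1) * j + r * b - (r - 1) * a)))
              * gauss t (L : ℤ) (((L : ℤ) + a - b) / 2 - r * j)
            - t ^ (4 * (((r - 1) * j + b) * (r * j + a)))
              * gauss t (L : ℤ) (((L : ℤ) - a - b) / 2 - r * j)) := by
  rw [finsum_sub_distrib]
  rotate_left
  · exact gauss_fin t L _ r (by omega) _
  · exact gauss_fin t L _ r (by omega) _
  rw [fermSum_eq ht]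
  have key : ∀ X Y : K, Y = t ^ (((a : ℤ) - b) * ((a : ℤ) - b - 1)) * X →
      t ^ (-(((a : ℤ) - b) * ((a : ℤ) - b - 1))) * Y = X := by
    intro X Y h
    rw [h, ← mul_assoc, ← zpow_add₀ ht.1, neg_add_cancel, zpow_zero, one_mul]
  apply key
  have hpar : L % 2 = QQ a b (d + 1) % 2 := by unfold QQ; omega
  have e : ∀ x, RR t a b d L x = ph t a b (d + 2) (a ≤ d + 1) (b ≤ d + 1) x L := by
    intro x
    rw [← RR_eq ht a b ha hb, if_pos hpar]
  simp only [e]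
  obtain ⟨k, hk⟩ : ∃ k : ℤ, k = d + 2 := ⟨_, rfl⟩
  obtain rfl : r = k + 1 := by omega
  rw [← hk]
  unfold ph
  by_cases h : a ≤ d + 1
  · simp only [if_pos h, if_pos hb', bAB, mul_sub, Finset.sum_sub_distrib]
    simp only [← mul_sub]
    rw [final_one ht k (by omega) (b - a) 0 (4 * b) (b - a) (by omega) (by omega) (by omega) (by omega) (by omega)
        L (by omega) (((a : ℤ) - b) * ((a : ℤ) - b - 1)) (L + a - b) 
        (fun j => 4 * (j * ((k + 1) * (k + 1 - 1) * j + (k + 1) * b - (k + 1 - 1) * a))) (by omega) (by intro j; ring),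
      final_one ht k (by omega) (a + b) 0 (4 * b) (b - a) (by omega) (by omega) (by omega) (by omega) (by omega)
        L (by omega) (((a : ℤ) - b) * ((a : ℤ) - b - 1)) (L - a - b) 
        (fun j => 4 * (((k + 1 - 1) * j + b) * ((k + 1) * j + a))) (by omega) (by intro j; ring), ← mul_sub (t ^ (((a : ℤ) - b) * ((a : ℤ) - b - 1)))]
  · obtain hak : (a : ℤ) = k := by omega
    simp only [if_neg h, if_pos hb', bB]
    have e2 : ∀ x y, SS t k (2 + (k - 1 - b)) 1 (4 * (k - 1 - b + 1)) (k - 1 - b) x y =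
        SS t k (k - 1 + b) 1 (4 * k + 4 * b) (k - 1 + 3 * b) x y := by
      intro x y
      rw [SS_reflect, SS_shift]
      apply SS_cong <;> ring
    simp only [e2, mul_sub (_ ^ _) (SS _ _ _ _ _ _ _ _), Finset.sum_sub_distrib]
    rw [final_one ht k (by omega) (-(k - 1 - b)) (-1) (-4 * (k - 1 - b + 1)) (k - 1 - b) (by omega) (by omega) (by omega) (by omega) (by omega)
        L (by omega) (((a : ℤ) - b) * ((a : ℤ) - b - 1)) (L + a - b) 
        (fun j => 4 * (j * ((k + 1) * (k + 1 - 1) * j + (k + 1) * b - (k + 1 - 1) * a))) (by omega) (by intro j; rw [hak]; ring),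
      final_one ht k (by omega) (k - 1 + b) 1 (4 * k + 4 * b) (k - 1 + 3 * b) (by omega) (by omega) (by omega) (by omega) (by omega)
        L (by omega) (((a : ℤ) - b) * ((a : ℤ) - b - 1)) (L - a - b) 
        (fun j => 4 * (((k + 1 - 1) * j + b) * ((k + 1) * j + a))) (by omega) (by intro j; rw [hak]; ring), ← mul_sub (t ^ (((a : ℤ) - b) * ((a : ℤ) - b - 1)))]

lemma gen_X : Gen (RatFunc.X : RatFunc ℚ) := by
  refine ⟨RatFunc.X_ne_zero, ?_⟩
  intro n hn h
  rw [← RatFunc.algebraMap_X, ← map_pow, ← map_one (algebraMap (Polynomial ℚ) (RatFunc ℚ))] at h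
  have h2 := RatFunc.algebraMap_injective ℚ h
  have h3 := congrArg Polynomial.natDegree h2
  simp at h3
  omega

end aux

/-- **Melzer's polynomial identities**. -/
theorem melzer_identity (r a b L : ℕ) (hr : 3 ≤ r) (ha : 1 ≤ a) (ha' : a ≤ r - 1)
    (hb : 1 ≤ b) (hb' : b ≤ r - 2)
    (hL : |(a : ℤ) - b| ≤ (L : ℤ) ∧ ((L : ℤ) - |(a : ℤ) - b|) % 2 = 0) :
    (RatFunc.X : RatFunc ℚ) ^ (-(((a : ℤ) - b) * ((a : ℤ) - b - 1))) * fermSum r a b L RatFunc.X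
      = ∑ᶠ j : ℤ,
          ((RatFunc.X : RatFunc ℚ) ^ (4 * (j * ((r : ℤ) * ((r : ℤ) - 1) * j + (r : ℤ) * b - ((r : ℤ) - 1) * a)))
              * gauss RatFunc.X (L : ℤ) (((L : ℤ) + a - b) / 2 - r * j)
            - (RatFunc.X : RatFunc ℚ) ^ (4 * ((((r : ℤ) - 1) * j + b) * ((r : ℤ) * j + a)))
              * gauss RatFunc.X (L : ℤ) (((L : ℤ) - a - b) / 2 - r * j)) := by
  obtain ⟨d, rfl⟩ : ∃ d, r = d + 3 := ⟨r - 3, by omega⟩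
  refine melzer_gen gen_X d a b L ha (by omega) hb (by omega) ?_ _ (by push_cast; ring)
  rcases abs_cases ((a : ℤ) - b) with h | h <;> omega
end
end

section
/- For all integers r ≥ 3, a ∈ {1,…,r−1}, b ∈ {1,…,r−2} and L ≥ 0 with L − |a−b| a nonnegative even integer, the one-dimensional configuration sum of the ABF model admits the fermionic evaluation X_L(a,b) = Σ_{m ≡ Q_{a,b}} q^{(1/4) mᵀC m − (1/2) m_{r−a−1}} ∏_{j=1}^{r−3} [ (1/2)(I m + L e_1 + e_{r−a−1} + e_{r−b−1})_j ; m_j ]. -/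
attribute [local instance] Classical.propDecidable

noncomputable section

variable {K : Type*} [Field K]

/-- The one-dimensional configuration sum `X_L(a,b,c)` of the ABF model:
the sum over all sequences `σ_0,…,σ_{L+1}` with values in `{0,…,r-2}`,
`|σ_{j+1} - σ_j| = 1`, `σ_0 = a-1`, `σ_L = b-1`, `σ_{L+1} = c-1`, of
`t^(Σ_{k=1}^L k|σ_{k+1} - σ_{k-1}|)`, where `t = q^{1/4}`. -/
def conf (r L a b c : ℕ) : RatFunc ℚ :=
  ∑ σ : Fin (L + 2) → Fin (r - 1),
    (fun s : ℕ → ℤ =>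
      if (∀ j, j ≤ L → |s (j + 1) - s j| = 1) ∧
          s 0 = (a : ℤ) - 1 ∧ s L = (b : ℤ) - 1 ∧ s (L + 1) = (c : ℤ) - 1
      then (RatFunc.X : RatFunc ℚ) ^ (∑ k ∈ Finset.Icc 1 L, (k : ℤ) * |s (k + 1) - s (k - 1)|)
      else 0)
    (fun j => if h : j < L + 2 then ((σ ⟨j, h⟩ : ℕ) : ℤ) else 0)

namespace ABF

/-- sign of a direction (`true` = up) -/
def sg (dir : Bool) : ℤ := if dir then 1 else -1

/-- offset between an edge of the path and the vertex of the reduced path -/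
def off (dir : Bool) : ℤ := if dir then 0 else -1

/-- Refined path generating function: paths on edges `0,…,R-1`, where `m` counts straight vertices. -/
def W (t : K) (R : ℤ) (s : Bool) (h0 : ℤ) : ℕ → Bool → ℤ → ℕ → K
  | 0, dir, h, m => if dir = s ∧ h = h0 ∧ m = 0 then 1 else 0
  | n + 1, dir, h, m =>
      if 0 ≤ h ∧ h < R then
        W t R s h0 n (!dir) h m
          + (if m = 0 then 0 else t ^ (2 * (n : ℤ)) * W t R s h0 n dir (h - sg dir) (m - 1))
      else 0

theorem W_out (t : K) (R : ℤ) (s : Bool) (h0 : ℤ) (h0R : 0 ≤ h0 ∧ h0 < R) (n : ℕ) (dir : Bool)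
    (h : ℤ) (m : ℕ) (hh : ¬ (0 ≤ h ∧ h < R)) : W t R s h0 n dir h m = 0 := by
  cases n with
  | zero =>
    simp only [W]
    rw [if_neg]
    rintro ⟨_, rfl, _⟩
    exact hh h0R
  | succ n => simp only [W]; rw [if_neg hh]

theorem W_supp (t : K) (R : ℤ) (s : Bool) (h0 : ℤ) (n : ℕ) : ∀ (dir : Bool)
    (h : ℤ) (m : ℕ), n < m → W t R s h0 n dir h m = 0 := by
  induction n with
  | zero =>
    intro dir h m hm
    simp only [W]
    rw [if_neg]
    omega
  | succ n ih =>
    intro dir h m hm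
    simp only [W]
    rw [ih _ _ _ (by omega), ih _ _ _ (by omega)]
    simp

/-- for paths starting at the top, vertex `0` is never straight -/
theorem W_supp_top (t : K) (R : ℤ) (n : ℕ) : ∀ (dir : Bool)
    (h : ℤ) (m : ℕ), n < m → W t R true (R - 1) (n + 1) dir h m = 0 := by
  induction n with
  | zero =>
    intro dir h m hm
    simp only [W]
    split_ifs with h1 h2 h3 h4 h5 h6
    all_goals first | rfl | (exfalso; omega) | skip
    all_goals first
      | (exfalso
         obtain ⟨hd, hh, _⟩ := ‹dir = true ∧ _›
         subst hd
         simp only [sg, if_true] at hh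
         omega)
      | simp
  | succ n ih =>
    intro dir h m hm
    rw [W, ih _ _ _ (by omega), ih _ _ _ (by omega)]
    simp

theorem W_step2 (t : K) (ht : t ≠ 0) (R : ℤ) (s : Bool) (h0 : ℤ) (n : ℕ) (dir : Bool) (h : ℤ)
    (m : ℕ) (hh : 0 ≤ h ∧ h < R) :
    W t R s h0 (n + 2) dir h (m + 1) = W t R s h0 n dir h (m + 1)
      + t ^ (2 * (n : ℤ)) * W t R s h0 n (!dir) (h - sg (!dir)) m
      + t ^ (2 * (n : ℤ) + 2) * W t R s h0 (n + 1) dir (h - sg dir) m := by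
  rw [W, if_pos hh]
  rw [show W t R s h0 (n + 1) (!dir) h (m + 1) = W t R s h0 n dir h (m + 1)
      + t ^ (2 * (n : ℤ)) * W t R s h0 n (!dir) (h - sg (!dir)) m by
    rw [W, if_pos hh]; simp]
  simp only [Nat.add_eq_zero_iff, one_ne_zero, and_false, if_false, Nat.add_sub_cancel]
  congr 3

theorem W_step0 (t : K) (R : ℤ) (s : Bool) (h0 : ℤ) (n : ℕ) (dir : Bool) (h : ℤ)
    (hh : 0 ≤ h ∧ h < R) :
    W t R s h0 (n + 2) dir h 0 = W t R s h0 n dir h 0 := by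
  rw [W, if_pos hh, W, if_pos hh]
  simp

/-- the case `a = r - 2` in terms of the case `a = r - 1` -/
theorem W_shift (t : K) (ht : t ≠ 0) (R : ℤ) (hR : 0 < R) (n : ℕ) : ∀ (dir : Bool) (h : ℤ) (m : ℕ),
    W t R true (R - 1) (n + 1) dir h m = t ^ (2 * (m : ℤ)) * W t R false (R - 1) n dir h m := by
  induction n with
  | zero =>
    intro dir h m
    simp only [W]
    rcases dir with _ | _ <;> simp [sg]
    · rcases m with _ | m
      · simp; omega
      · simp
    · intros; omega
  | succ n ih =>
    intro dir h m
    rw [W, show W t R false (R - 1) (n + 1) dir h m = if 0 ≤ h ∧ h < R then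
        W t R false (R - 1) n (!dir) h m
          + (if m = 0 then 0 else t ^ (2 * (n : ℤ)) * W t R false (R - 1) n dir (h - sg dir) (m - 1))
      else 0 from rfl]
    split_ifs with h1 h2
    · rw [ih]; simp
    · rw [ih, ih]
      obtain ⟨k, rfl⟩ : ∃ k, m = k + 1 := ⟨m - 1, by omega⟩
      rw [mul_add]
      congr 1
      simp only [Nat.add_sub_cancel]
      rw [← mul_assoc, ← mul_assoc, ← zpow_add₀ ht, ← zpow_add₀ ht]
      congr 2
      push_cast; ring
    · simp

theorem qp_succ (t : K) (n : ℕ) : qp t (n + 1) = qp t n * (1 - t ^ (4 * (n + 1))) := by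
  simp [qp, Finset.prod_range_succ]

theorem gauss_pascal (t : K) (hq : ∀ n, qp t n ≠ 0) (N m : ℤ) (hm : 1 ≤ m) :
    gauss t N m = gauss t (N - 1) m + t ^ (4 * (N - m)) * gauss t (N - 1) (m - 1) := by
  rcases lt_trichotomy m N with h | h | h
  · obtain ⟨k, hk⟩ : ∃ k : ℕ, m = k + 1 := ⟨(m - 1).toNat, by omega⟩
    obtain ⟨l, hl⟩ : ∃ l : ℕ, N = k + l + 2 := ⟨(N - k - 2).toNat, by omega⟩
    subst hk hl
    unfold gauss
    rw [if_pos (by omega), if_pos (by omega), if_pos (by omega)]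
    rw [show ((k : ℤ) + l + 2).toNat = (k + l + 1) + 1 by omega,
      show ((k : ℤ) + 1).toNat = k + 1 by omega,
      show ((k : ℤ) + l + 2 - (k + 1)).toNat = l + 1 by omega,
      show ((k : ℤ) + l + 2 - 1).toNat = k + l + 1 by omega,
      show ((k : ℤ) + l + 2 - 1 - (k + 1)).toNat = l by omega,
      show ((k : ℤ) + 1 - 1).toNat = k by omega,
      show ((k : ℤ) + l + 2 - 1 - (k + 1 - 1)).toNat = l + 1 by omega,
      show (4 * ((k : ℤ) + l + 2 - (k + 1))) = ((4 * (l + 1) : ℕ) : ℤ) by push_cast; ring,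
      zpow_natCast, qp_succ t (k + l + 1), qp_succ t k, qp_succ t l]
    have h1 := hq k
    have h2 := hq l
    have h3 := hq (k + 1)
    have h4 := hq (l + 1)
    rw [qp_succ] at h3 h4
    have h5 := right_ne_zero_of_mul h3
    have h6 := right_ne_zero_of_mul h4
    field_simp
    ring
  · subst h
    unfold gauss
    rw [if_pos (by omega), if_neg (by omega), if_pos (by omega)]
    simp [qp]
    rw [div_self, div_self]
    · exact hq _
    · exact hq _
  · unfold gauss
    rw [if_neg (by omega), if_neg (by omega), if_neg (by omega)]
    simp

theorem gH_pascal (t : K) (hq : ∀ n, qp t n ≠ 0) (N m : ℤ) (hm : 1 ≤ m) :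
    gaussHalf t N m = gaussHalf t (N - 2) m
      + t ^ (2 * N - 4 * m) * gaussHalf t (N - 2) (m - 1) := by
  unfold gaussHalf
  by_cases h : N % 2 = 0
  · rw [if_pos h, if_pos (by omega), if_pos (by omega), gauss_pascal t hq _ _ hm,
      show (N - 2) / 2 = N / 2 - 1 by omega, show 2 * N - 4 * m = 4 * (N / 2 - m) by omega]
  · rw [if_neg h, if_neg (by omega), if_neg (by omega)]; simp

theorem gH_zero_of_lt (t : K) (N m : ℤ) (h : N < 2 * m) : gaussHalf t N m = 0 := by
  unfold gaussHalf gauss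
  split_ifs <;> first | rfl | omega

theorem gH_zero (t : K) (hq : ∀ n, qp t n ≠ 0) (N : ℤ) :
    gaussHalf t N 0 = if 0 ≤ N ∧ N % 2 = 0 then 1 else 0 := by
  unfold gaussHalf gauss
  split_ifs <;> first | rfl | omega | skip
  have := hq (N / 2).toNat
  rw [show (0 : ℤ).toNat = 0 from rfl, sub_zero, show qp t 0 = 1 by simp [qp], one_mul]
  exact div_self (hq _)

/-- the right-hand side of the reduction formula -/
def RHS (t : K) (R : ℤ) (s : Bool) (h0 : ℤ) (M : ℕ) (n : ℤ) (dir : Bool) (g : ℤ) (m : ℕ) : K :=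
  ∑ μ ∈ Finset.range M, t ^ (2 * (m : ℤ) ^ 2 - 2 * m * μ) * gaussHalf t (n - 1 + μ) m
    * W t R s h0 (m + 1) dir g μ

theorem RHS_step (t : K) (ht : t ≠ 0) (hq : ∀ n, qp t n ≠ 0) (R : ℤ) (s : Bool) (h0 : ℤ)
    (M : ℕ) (n : ℤ) (dir : Bool) (g : ℤ) (hg : 0 ≤ g ∧ g < R) (m : ℕ) (hM : m + 3 ≤ M) :
    RHS t R s h0 M (n + 2) dir g (m + 1) = RHS t R s h0 M n dir g (m + 1)
      + t ^ (2 * n) * RHS t R s h0 M n (!dir) g m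
      + t ^ (2 * n + 2) * RHS t R s h0 M (n + 1) dir (g - sg dir) m := by
  have key : RHS t R s h0 M (n + 2) dir g (m + 1) = RHS t R s h0 M n dir g (m + 1)
      + ∑ μ ∈ Finset.range M, t ^ (2 * ((m : ℤ) + 1) ^ 2 - 2 * (m + 1) * μ
          + (2 * (n + 1 + μ) - 4 * (m + 1)))
        * gaussHalf t (n - 1 + μ) m * W t R s h0 (m + 2) dir g μ := by
    unfold RHS
    rw [← Finset.sum_add_distrib]
    refine Finset.sum_congr rfl fun μ _ => ?_
    rw [gH_pascal t hq (n + 2 - 1 + μ) _ (by push_cast; omega)]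
    rw [show n + 2 - 1 + (μ : ℤ) - 2 = n - 1 + μ by ring, zpow_add₀ ht]
    push_cast
    rw [show (m : ℤ) + 1 - 1 = m by ring, show n + 2 - 1 + (μ : ℤ) = n + 1 + μ by ring]
    ring
  rw [key, add_assoc]
  congr 1
  unfold RHS
  rw [Finset.mul_sum, Finset.mul_sum]
  obtain ⟨M', rfl⟩ : ∃ M', M = M' + 1 := ⟨M - 1, by omega⟩
  rw [Finset.sum_range_succ (fun μ : ℕ => t ^ (2 * n + 2) * _),
    W_supp t R s h0 (m + 1) _ _ M' (by omega), mul_zero, mul_zero, add_zero]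
  have split : ∀ μ, W t R s h0 (m + 2) dir g μ = W t R s h0 (m + 1) (!dir) g μ
      + (if μ = 0 then 0 else t ^ (2 * ((m : ℤ) + 1)) * W t R s h0 (m + 1) dir (g - sg dir) (μ - 1)) := by
    intro μ
    rw [W, if_pos hg]
    push_cast
    rfl
  simp_rw [split, mul_add]
  rw [Finset.sum_add_distrib]
  congr 1
  · refine Finset.sum_congr rfl fun μ _ => ?_
    rw [← mul_assoc, ← mul_assoc, ← zpow_add₀ ht]
    congr 3
    ring
  · rw [Finset.sum_range_succ']
    simp only [if_true, mul_zero, add_zero, Nat.add_eq_zero_iff, one_ne_zero, and_false, if_false,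
      Nat.add_sub_cancel]
    refine Finset.sum_congr rfl fun μ _ => ?_
    have e1 : n - 1 + ((μ + 1 : ℕ) : ℤ) = n + 1 - 1 + μ := by push_cast; ring
    rw [e1]
    rw [show ∀ a b c d : K, a * b * (c * d) = (a * c) * b * d by intros; ring,
      ← mul_assoc, ← mul_assoc, ← zpow_add₀ ht, ← zpow_add₀ ht]
    congr 3
    push_cast
    ring

theorem RHS_out (t : K) (R : ℤ) (s : Bool) (h0 : ℤ) 
    (M : ℕ) (n : ℤ) (dir : Bool) (g : ℤ) (hg : ¬ (0 ≤ g ∧ g < R)) (m : ℕ) :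
    RHS t R s h0 M n dir g m = 0 := by
  unfold RHS
  refine Finset.sum_eq_zero fun μ _ => ?_
  rw [W, if_neg hg, mul_zero]

theorem transform (t : K) (ht : t ≠ 0) (hq : ∀ n, qp t n ≠ 0) (R : ℤ) (s s' : Bool) (h0 h0' : ℤ)
    (h0R : 0 ≤ h0 ∧ h0 < R)
    (B0 : ∀ (M n : ℕ) (dir : Bool) (h : ℤ), 2 ≤ M → 0 ≤ h + off dir ∧ h + off dir < R - 1 →
      n < 2 →
      W t R s h0 n dir h 0 = RHS t (R - 1) s' h0' M n dir (h + off dir) 0)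
    (B0' : ∀ (M n : ℕ) (dir : Bool) (h : ℤ), 2 ≤ M → 0 ≤ h + off dir ∧ h + off dir < R - 1 →
      RHS t (R - 1) s' h0' M ((n + 2 : ℕ) : ℤ) dir (h + off dir) 0
        = RHS t (R - 1) s' h0' M n dir (h + off dir) 0)
    (B1 : ∀ (M n m : ℕ) (dir : Bool) (h : ℤ), m + 3 ≤ M → 0 ≤ h + off dir ∧ h + off dir < R - 1 →
      n < 2 →
      W t R s h0 n dir h (m + 1) = RHS t (R - 1) s' h0' M n dir (h + off dir) (m + 1))
    (n : ℕ) : ∀ (M m : ℕ) (dir : Bool) (h : ℤ), m + 2 ≤ M → 0 ≤ h + off dir ∧ h + off dir < R - 1 →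
      W t R s h0 n dir h m = RHS t (R - 1) s' h0' M n dir (h + off dir) m := by
  induction n using Nat.strong_induction_on with
  | _ n ih =>
  intro M m dir h hM hh
  by_cases hn : n < 2
  · rcases m with _ | m
    · exact B0 M n dir h hM hh hn
    · exact B1 M n m dir h hM hh hn
  obtain ⟨n, rfl⟩ : ∃ k, n = k + 2 := ⟨n - 2, by omega⟩
  have hhR : 0 ≤ h ∧ h < R := by
    revert hh; unfold off; split_ifs <;> omega
  rcases m with _ | m
  · rw [B0' M n dir h hM hh, ← ih n (by omega) M 0 dir h hM hh, W_step0 _ _ _ _ _ _ _ hhR]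
  · rw [W_step2 t ht _ _ _ _ _ _ _ hhR]
    have e : ((n + 2 : ℕ) : ℤ) = (n : ℤ) + 2 := by push_cast; ring
    rw [e, RHS_step t ht hq _ _ _ _ _ _ _ hh _ (by omega),
      ih n (by omega) M (m + 1) dir h hM hh]
    have e2 : h - sg (!dir) + off (!dir) = h + off dir := by
      rcases dir <;> simp [sg, off] <;> ring
    rw [ih n (by omega) M m (!dir) (h - sg (!dir)) (by omega) (by rw [e2]; exact hh), e2]
    congr 2
    have e3 : h - sg dir + off dir = h + off dir - sg dir := by ring
    by_cases hg : 0 ≤ h + off dir - sg dir ∧ h + off dir - sg dir < R - 1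
    · rw [ih (n + 1) (by omega) M m dir (h - sg dir) (by omega) (by rw [e3]; exact hg), e3]
      push_cast; rfl
    · rw [RHS_out _ _ _ _ _ _ _ _ hg, W_out _ _ _ _ h0R]
      revert hh hg
      rcases dir <;> simp [sg, off] <;> intros <;> omega

theorem RHS_zero (t : K) (hq : ∀ n, qp t n ≠ 0) (R : ℤ) (s : Bool) (h0 : ℤ)
    (M n : ℕ) (hM : 2 ≤ M) (dir : Bool) (g : ℤ) :
    RHS t R s h0 M n dir g 0 = (if n % 2 = 1 then W t R s h0 1 dir g 0 else 0)
      + (if n % 2 = 0 then W t R s h0 1 dir g 1 else 0) := by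
  obtain ⟨M, rfl⟩ : ∃ k, M = k + 2 := ⟨M - 2, by omega⟩
  unfold RHS
  rw [Finset.sum_range_succ', Finset.sum_range_succ', Finset.sum_eq_zero]
  · simp only [Nat.cast_zero, gH_zero t hq]
    by_cases h : n % 2 = 0
    · rw [if_pos (by push_cast; omega), if_neg (by push_cast; omega), if_neg (by omega), if_pos h]
      simp
    · rw [if_neg (by push_cast; omega), if_pos (by push_cast; omega), if_pos (by omega), if_neg h]
      simp
  · intro μ _
    rw [W_supp _ _ _ _ _ _ _ _ (by omega), mul_zero]

theorem RHS_zero_step (t : K) (hq : ∀ n, qp t n ≠ 0) (R : ℤ) (s : Bool) (h0 : ℤ)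
    (M n : ℕ) (hM : 2 ≤ M) (dir : Bool) (g : ℤ) :
    RHS t R s h0 M ((n + 2 : ℕ) : ℤ) dir g 0 = RHS t R s h0 M n dir g 0 := by
  rw [RHS_zero t hq _ _ _ _ _ hM, RHS_zero t hq _ _ _ _ _ hM, Nat.add_mod_right]

theorem transform_top (t : K) (ht : t ≠ 0) (hq : ∀ n, qp t n ≠ 0) (R : ℤ) (hR : 2 ≤ R)
    (n M m : ℕ) (dir : Bool) (h : ℤ) (hM : m + 2 ≤ M)
    (hh : 0 ≤ h + off dir ∧ h + off dir < R - 1) :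
    W t R true (R - 1) n dir h m = RHS t (R - 1) true (R - 1 - 1) M n dir (h + off dir) m := by
  refine transform t ht hq R true true _ _ (by omega) ?_ ?_ ?_ n M m dir h hM hh
  · intro M n dir h hM hh hn
    rw [RHS_zero t hq _ _ _ _ _ hM, W_supp_top _ _ 0 _ _ 1 (by omega)]
    have hhR : 0 ≤ h ∧ h < R := by
      revert hh; unfold off; split_ifs <;> omega
    simp only [W, if_pos hh]
    interval_cases n
    · simp [W]
      rintro rfl
      simp [off] at hh
      omega
    · simp only [W, if_pos hhR]
      rcases dir <;> simp [off]
      congr 1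
      apply propext
      omega
  · intro M n dir h hM hh
    exact RHS_zero_step t hq _ _ _ _ _ hM _ _
  · intro M n m dir h hM hh hn
    have hz : RHS t (R - 1) true (R - 1 - 1) M n dir (h + off dir) (m + 1) = 0 := by
      unfold RHS
      refine Finset.sum_eq_zero fun μ _ => ?_
      by_cases hμ : m + 1 < μ
      · rw [W_supp_top _ _ _ _ _ _ hμ, mul_zero]
      · rw [gH_zero_of_lt _ _ _ (by push_cast; omega)]; simp
    rw [hz]
    interval_cases n
    · simp [W]
    · exact W_supp_top _ _ 0 _ _ _ (by omega)

theorem transform_gen (t : K) (ht : t ≠ 0) (hq : ∀ n, qp t n ≠ 0) (R h0 : ℤ)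
    (h0R : 0 ≤ h0 ∧ h0 < R - 1)
    (n M m : ℕ) (dir : Bool) (h : ℤ) (hM : m + 2 ≤ M)
    (hh : 0 ≤ h + off dir ∧ h + off dir < R - 1) :
    W t R false h0 n dir h m = RHS t (R - 1) false h0 M n dir (h + off dir) m := by
  refine transform t ht hq R false false _ _ (by omega) ?_ ?_ ?_ n M m dir h hM hh
  · intro M n dir h hM hh hn
    rw [RHS_zero t hq _ _ _ _ _ hM]
    have hhR : 0 ≤ h ∧ h < R := by
      revert hh; unfold off; split_ifs <;> omega
    simp only [W, if_pos hh]
    interval_cases n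
    · rcases dir <;> simp [W, off, sg]
    · simp only [W, if_pos hhR]
      rcases dir <;> simp [off]
  · intro M n dir h hM hh
    exact RHS_zero_step t hq _ _ _ _ _ hM _ _
  · intro M n m dir h hM hh hn
    have hhR : 0 ≤ h ∧ h < R := by
      revert hh; unfold off; split_ifs <;> omega
    by_cases hc : n = 1 ∧ m = 0
    · obtain ⟨rfl, rfl⟩ := hc
      unfold RHS
      rw [Finset.sum_eq_single 2]
      · rw [show gaussHalf t (((1 : ℕ) : ℤ) - 1 + ((2 : ℕ) : ℤ)) ((0 + 1 : ℕ) : ℤ) = 1 by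
          simp [gaussHalf, gauss, qp]
          have := hq 1
          simpa [qp] using this]
        simp only [W, if_pos hh, if_pos hhR]
        rcases dir
        · simp [off, sg] at hh ⊢
          by_cases h1 : h = h0 - 1
          · subst h1
            simp
            rw [if_pos ⟨by omega, by omega⟩]
            field_simp
          · split_ifs <;> first | (exfalso; omega) | simp
        · simp [off, sg]
      · intro μ _ hμ
        by_cases h2 : 2 < μ
        · rw [W_supp _ _ _ _ _ _ _ _ (by omega), mul_zero]
        · rw [gH_zero_of_lt _ _ _ (by push_cast; omega)]; simp
      · intro h2; simp at h2; omega
    · have hz : RHS t (R - 1) false h0 M n dir (h + off dir) (m + 1) = 0 := by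
        unfold RHS
        refine Finset.sum_eq_zero fun μ _ => ?_
        by_cases hμ : m + 2 < μ
        · rw [W_supp _ _ _ _ _ _ _ _ (by omega), mul_zero]
        · rw [gH_zero_of_lt _ _ _ (by push_cast; omega)]; simp
      rw [hz]
      interval_cases n
      · simp [W]
      · simp [W]
        intros
        simp_all

/-- starting direction for the height `a` when there are `R` edges -/
def sdir (R a : ℕ) : Bool := decide (R < a)

/-- starting edge -/
def sh (R a : ℕ) : ℤ := if R < a then (R : ℤ) - 1 else (a : ℤ) - 1

/-- refined configuration sum with `r = d + 3` -/
def Z (t : K) (d L a b m : ℕ) : K :=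
  if b ≤ d + 1 then W t (d + 1 : ℕ) (sdir (d + 1) a) (sh (d + 1) a) (L + 1) true ((b : ℤ) - 1) m
  else W t (d + 1 : ℕ) (sdir (d + 1) a) (sh (d + 1) a) (L + 1) false d m

theorem transform_all (t : K) (ht : t ≠ 0) (hq : ∀ n, qp t n ≠ 0) (d a : ℕ) (ha : 1 ≤ a)
    (ha' : a ≤ d + 3) (n m : ℕ) (dir : Bool) (h : ℤ) 
    (hh : 0 ≤ h + off dir ∧ h + off dir < d + 1) :
    W t (d + 2 : ℕ) (sdir (d + 2) a) (sh (d + 2) a) n dir h m =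
      t ^ (2 * (m : ℤ) ^ 2 - 2 * (if a = d + 2 then 1 else 0) * m) *
      ∑ μ ∈ Finset.range (m + 2), t ^ (- 2 * (m : ℤ) * μ) *
        gaussHalf t ((n : ℤ) - 1 + (if a = d + 2 then 1 else 0) + μ) m
        * W t (d + 1 : ℕ) (sdir (d + 1) (min a (d + 2))) (sh (d + 1) (min a (d + 2)))
          (m + 1) dir (h + off dir) μ := by
  have hR : ((d + 2 : ℕ) : ℤ) - 1 = ((d + 1 : ℕ) : ℤ) := by push_cast; ring
  have hh' : 0 ≤ h + off dir ∧ h + off dir < ((d + 2 : ℕ) : ℤ) - 1 := by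
    rw [hR]; push_cast; exact hh
  have common : ∀ (n : ℤ) (e : ℤ) (s : Bool) (h0 : ℤ), e = 0 →
      RHS t ((d + 1 : ℕ) : ℤ) s h0 (m + 2) n dir (h + off dir) m =
      t ^ (2 * (m : ℤ) ^ 2 - 2 * e * m) *
      ∑ μ ∈ Finset.range (m + 2), t ^ (- 2 * (m : ℤ) * μ) *
        gaussHalf t (n - 1 + μ) m * W t (d + 1 : ℕ) s h0 (m + 1) dir (h + off dir) μ := by
    intro n e s h0 he
    subst he
    unfold RHS
    rw [Finset.mul_sum]
    refine Finset.sum_congr rfl fun μ _ => ?_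
    rw [← mul_assoc, ← mul_assoc, ← zpow_add₀ ht]
    congr 3
    ring
  rcases lt_trichotomy a (d + 2) with h1 | h1 | h1
  · rw [show min a (d + 2) = a by omega]
    have e1 : sdir (d + 2) a = false := by simp [sdir]; omega
    have e2 : sdir (d + 1) a = false := by simp [sdir]; omega
    have e3 : sh (d + 2) a = (a : ℤ) - 1 := by rw [sh, if_neg (by omega)]
    have e4 : sh (d + 1) a = (a : ℤ) - 1 := by rw [sh, if_neg (by omega)]
    rw [e1, e2, e3, e4, transform_gen t ht hq _ _ (by push_cast; omega) n (m + 2) m dir h le_rfl hh',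
      hR, if_neg (by omega), add_zero]
    exact common _ 0 _ _ rfl
  · subst h1
    rw [min_self, if_pos rfl]
    have e1 : sdir (d + 2) (d + 2) = false := by simp [sdir]
    have e2 : sdir (d + 1) (d + 2) = true := by simp [sdir]
    have e3 : sh (d + 2) (d + 2) = ((d + 2 : ℕ) : ℤ) - 1 := by rw [sh, if_neg (by omega)]
    have e4 : sh (d + 1) (d + 2) = ((d + 1 : ℕ) : ℤ) - 1 := by rw [sh, if_pos (by omega)]
    have k := W_shift t ht ((d + 2 : ℕ) : ℤ) (by push_cast; omega) n dir h m
    rw [transform_top t ht hq _ (by push_cast; omega) (n + 1) (m + 2) m dir h le_rfl hh',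
      hR, common _ 0 _ _ rfl] at k
    rw [e1, e2, e3, e4]
    rw [hR]
    have htm : t ^ (2 * (m : ℤ)) ≠ 0 := zpow_ne_zero _ ht
    apply mul_left_cancel₀ htm
    rw [← k, ← mul_assoc, ← zpow_add₀ ht]
    congr 1
    · congr 1; ring
    · refine Finset.sum_congr rfl fun μ _ => ?_
      congr 3
      push_cast; ring
  · obtain rfl : a = d + 3 := by omega
    rw [show min (d + 3) (d + 2) = d + 2 by omega]
    have e1 : sdir (d + 2) (d + 3) = true := by simp [sdir]
    have e2 : sdir (d + 1) (d + 2) = true := by simp [sdir]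
    have e3 : sh (d + 2) (d + 3) = ((d + 2 : ℕ) : ℤ) - 1 := by rw [sh, if_pos (by omega)]
    have e4 : sh (d + 1) (d + 2) = ((d + 1 : ℕ) : ℤ) - 1 := by rw [sh, if_pos (by omega)]
    rw [e1, e2, e3, e4, transform_top t ht hq _ (by push_cast; omega) n (m + 2) m dir h le_rfl hh',
      hR, if_neg (by omega), add_zero]
    exact common _ 0 _ _ rfl

theorem sh_range (R a : ℕ) (hR : 1 ≤ R) (ha : 1 ≤ a) : 0 ≤ sh R a ∧ sh R a < R := by
  unfold sh
  split_ifs <;> omega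

theorem Z_step (t : K) (ht : t ≠ 0) (hq : ∀ n, qp t n ≠ 0) (d a b L m : ℕ) (ha : 1 ≤ a)
    (ha' : a ≤ d + 3) (hb : 1 ≤ b) (hb' : b ≤ d + 3) :
    Z t (d + 1) L a b m =
      t ^ (2 * (m : ℤ) ^ 2 - 2 * (if a = d + 2 then 1 else 0) * m) *
      ∑ μ ∈ Finset.range (m + 2), t ^ (- 2 * (m : ℤ) * μ) *
        gaussHalf t (μ + L + (if a = d + 2 then 1 else 0) + (if b = d + 2 then 1 else 0)) m
        * Z t d m (min a (d + 2)) (min b (d + 2)) μ := by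
  unfold Z
  rcases lt_trichotomy b (d + 2) with h1 | h1 | h1
  · rw [if_pos (by omega), show d + 1 + 1 = d + 2 from rfl, transform_all t ht hq d a ha ha' _ _ _ _
      (by simp [off]; omega)]
    congr 1
    refine Finset.sum_congr rfl fun μ _ => ?_
    rw [show min b (d + 2) = b by omega, if_pos (show b ≤ d + 1 by omega),
      if_neg (show b ≠ d + 2 by omega)]
    congr 2
    · congr 1; push_cast; ring
    · simp [off]
  · subst h1
    have k : W t (d + 2 : ℕ) (sdir (d + 2) a) (sh (d + 2) a) (L + 1) true (((d + 2 : ℕ) : ℤ) - 1) m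
        = W t (d + 2 : ℕ) (sdir (d + 2) a) (sh (d + 2) a) (L + 2) false (((d + 2 : ℕ) : ℤ) - 1) m := by
      conv_rhs => rw [W]
      rw [if_pos (by push_cast; omega), W_out _ _ _ _ (sh_range (d + 2) a (by omega) ha) _ false]
      · simp
      · simp [sg]
    rw [if_pos (by omega), show d + 1 + 1 = d + 2 from rfl, k,
      transform_all t ht hq d a ha ha' _ _ _ _ (by simp [off]; omega)]
    congr 1
    refine Finset.sum_congr rfl fun μ _ => ?_
    rw [min_self, if_neg (show ¬ d + 2 ≤ d + 1 by omega), if_pos (show d + 2 = d + 2 from rfl)]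
    congr 2
    · congr 1; push_cast; ring
    · simp [off]
      congr 1
      ring
  · obtain rfl : b = d + 3 := by omega
    rw [if_neg (by omega), show d + 1 + 1 = d + 2 from rfl, 
      transform_all t ht hq d a ha ha' _ _ _ _ (by simp [off])]
    congr 1
    refine Finset.sum_congr rfl fun μ _ => ?_
    rw [show min (d + 3) (d + 2) = d + 2 by omega, if_neg (show ¬ d + 2 ≤ d + 1 by omega),
      if_neg (show ¬ d + 3 = d + 2 by omega)]
    congr 2
    · congr 1; push_cast; ring
    · simp [off]

theorem W_parity (t : K) (R : ℤ) (s : Bool) (h0 : ℤ) (n : ℕ) : ∀ (dir : Bool) (h : ℤ) (m : ℕ),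
    (n + h + h0 + (if dir = s then 0 else 1)) % 2 ≠ 0 → W t R s h0 n dir h m = 0 := by
  induction n with
  | zero =>
    intro dir h m hp
    simp only [W]
    rw [if_neg]
    rintro ⟨rfl, rfl, _⟩
    rw [if_pos rfl] at hp
    push_cast at hp
    omega
  | succ n ih =>
    intro dir h m hp
    push_cast at hp
    rw [W, ih, ih]
    · simp
    · revert hp
      rcases dir <;> rcases s <;> simp [sg] <;> omega
    · revert hp
      rcases dir <;> rcases s <;> simp <;> omega

theorem Z_parity (t : K) (d L a b m : ℕ) (ha : 1 ≤ a) (ha' : a ≤ d + 2) (hb : 1 ≤ b)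
    (hb' : b ≤ d + 2) (h : (L + a + b) % 2 ≠ 0) : Z t d L a b m = 0 := by
  unfold Z sdir sh
  split_ifs with h1 h2 h3
  all_goals
    apply W_parity
    first
    | rw [decide_eq_true (by omega)]
    | rw [decide_eq_false (by omega)]
    simp
    omega

theorem Z_supp (t : K) (d L a b m : ℕ) (h : L + 1 < m) : Z t d L a b m = 0 := by
  unfold Z
  split_ifs <;> exact W_supp _ _ _ _ _ _ _ _ h

theorem Z_base (t : K) (L a b m : ℕ) (ha : 1 ≤ a) (ha' : a ≤ 2) (hb : 1 ≤ b)
    (hb' : b ≤ 2) (h : (L + a + b) % 2 = 0) : Z t 0 L a b m = if m = 0 then 1 else 0 := by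
  have key : ∀ (s : Bool) (n : ℕ) (dir : Bool) (m : ℕ), W t 1 s 0 n dir 0 m =
      if (n + (if dir = s then 0 else 1)) % 2 = 0 ∧ m = 0 then 1 else 0 := by
    intro s n
    induction n with
    | zero => 
      intro dir m
      rcases dir <;> rcases s <;> simp [W]
    | succ n ih =>
      intro dir m
      rw [W, if_pos (by norm_num), ih, W_out t 1 s 0 (by norm_num)]
      · simp
        congr 1
        apply propext
        rcases dir <;> rcases s <;> simp <;> omega
      · rcases dir <;> simp [sg]
  unfold Z sdir sh
  have e1 : (if 0 + 1 < a then (((0 + 1 : ℕ)) : ℤ) - 1 else (a : ℤ) - 1) = 0 := by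
    split_ifs
    · simp
    · omega
  rw [e1]
  simp only [Nat.cast_zero, zero_add, Nat.cast_one]
  interval_cases a <;> interval_cases b <;> simp [key] <;>
    (congr 1; apply propext; omega)

/-- parity restriction with `r = d + 3` -/
def par (d a b : ℕ) (v : Fin d → ℕ) : Prop :=
  ∀ i : Fin d, v i % 2 = (min (a - 1) (d + 3 - ((i : ℕ) + 1) - 2)
    + min (b - 1) (d + 3 - ((i : ℕ) + 1) - 2)) % 2

/-- twice the upper entries of the Gaussian polynomials, with `r = d + 3` -/
def top (d a b L : ℕ) (v : Fin d → ℕ) (i : Fin d) : ℤ :=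
  (∑ k, inc d i k * (v k : ℤ)) + (L : ℤ) * uv d 1 i
    + uv d (((d + 3 : ℕ) : ℤ) - a - 1) i + uv d (((d + 3 : ℕ) : ℤ) - b - 1) i

/-- the summand of the fermionic sum with `r = d + 3` -/
def T (t : K) (d a b L : ℕ) (v : Fin d → ℕ) : K :=
  if par d a b v then
    t ^ (quadC d v - 2 * mAt d v (((d + 3 : ℕ) : ℤ) - a - 1))
      * ∏ i, gaussHalf t (top d a b L v i) (v i)
  else 0

theorem fermSum_eq (t : K) (d a b L : ℕ) : fermSum (d + 3) a b L t = ∑ᶠ v, T t d a b L v := rfl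

/-- first component -/
def hd (d : ℕ) (v : Fin d → ℕ) : ℕ := if h : 0 < d then v ⟨0, h⟩ else 0

theorem sum_hd (d : ℕ) (v : Fin d → ℕ) :
    ∑ k : Fin d, (if (k : ℕ) = 0 then (1 : ℤ) else 0) * (v k : ℤ) = hd d v := by
  unfold hd
  rcases d with _ | d
  · simp
  · rw [Fin.sum_univ_succ]
    simp

theorem inc_zero_succ (d : ℕ) (k : Fin d) :
    inc (d + 1) 0 k.succ = if (k : ℕ) = 0 then 1 else 0 := by
  simp [inc, eq_comm]

theorem inc_succ_zero (d : ℕ) (k : Fin d) :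
    inc (d + 1) k.succ 0 = if (k : ℕ) = 0 then 1 else 0 := by
  simp [inc, eq_comm]

theorem inc_zero_zero (d : ℕ) : inc (d + 1) 0 0 = 0 := by
  simp [inc]

theorem inc_succ_succ (d : ℕ) (i k : Fin d) : inc (d + 1) i.succ k.succ = inc d i k := by
  simp [inc]

theorem uv_zero (d : ℕ) (s : ℤ) : uv (d + 1) s 0 = if s = 1 then 1 else 0 := by
  simp [uv, eq_comm]

theorem uv_succ (d : ℕ) (s : ℤ) (i : Fin d) : uv (d + 1) s i.succ = uv d (s - 1) i := by
  unfold uv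
  congr 1
  apply propext
  simp only [Fin.val_succ]
  push_cast
  omega

theorem uv_nonpos (d : ℕ) (s : ℤ) (hs : s ≤ 0) (i : Fin d) : uv d s i = 0 := by
  unfold uv
  rw [if_neg]
  omega

theorem quadC_cons (d m : ℕ) (v : Fin d → ℕ) :
    quadC (d + 1) (Fin.cons m v) = 2 * (m : ℤ) ^ 2 - 2 * m * hd d v + quadC d v := by
  unfold quadC
  rw [Fin.sum_univ_succ, Fin.sum_univ_succ]
  simp_rw [Fin.sum_univ_succ]
  simp only [Fin.cons_zero, Fin.cons_succ, cartan, inc_zero_succ, inc_succ_zero, inc_zero_zero,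
    inc_succ_succ, Fin.succ_inj, (Fin.succ_ne_zero _).symm, Fin.succ_ne_zero, if_false, if_true]
  rw [Finset.sum_add_distrib, ← sum_hd, Finset.mul_sum]
  have : ∀ k : Fin d, (v k : ℤ) * (0 - if (k : ℕ) = 0 then 1 else 0) * (m : ℤ)
     = (m : ℤ) * (0 - if (k : ℕ) = 0 then 1 else 0) * (v k : ℤ) := by intro k; ring
  simp_rw [this]
  have h2 : ∑ k : Fin d, (2 * (m : ℤ) * ((if (k : ℕ) = 0 then (1 : ℤ) else 0) * (v k : ℤ)))
      = - (∑ k : Fin d, (m : ℤ) * (0 - if (k : ℕ) = 0 then 1 else 0) * (v k : ℤ))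
        - (∑ k : Fin d, (m : ℤ) * (0 - if (k : ℕ) = 0 then 1 else 0) * (v k : ℤ)) := by
    rw [← Finset.sum_neg_distrib, ← Finset.sum_sub_distrib]
    refine Finset.sum_congr rfl fun k _ => ?_
    ring
  rw [h2]
  ring

theorem mAt_cons (d m : ℕ) (v : Fin d → ℕ) (s : ℤ) :
    mAt (d + 1) (Fin.cons m v) s = (if s = 1 then 1 else 0) * m + mAt d v (s - 1) := by
  unfold mAt
  rw [Fin.sum_univ_succ]
  simp [uv_zero, uv_succ]

theorem uv_reduce (d a : ℕ) (ha' : a ≤ d + 3) (i : Fin d) :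
    uv d (((d + 1 + 3 : ℕ) : ℤ) - a - 1 - 1) i
      = uv d (((d + 3 : ℕ) : ℤ) - (min a (d + 2) : ℕ) - 1) i := by
  by_cases h : a ≤ d + 2
  · rw [min_eq_left h]; congr 1; push_cast; ring
  · rw [uv_nonpos, uv_nonpos]
    · rw [min_eq_right (by omega)]; push_cast; omega
    · push_cast; omega

theorem top_zero (d a b L m : ℕ) (v : Fin d → ℕ) :
    top (d + 1) a b L (Fin.cons m v) 0 = hd d v + L + (if a = d + 2 then 1 else 0)
      + (if b = d + 2 then 1 else 0) := by
  unfold top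
  rw [Fin.sum_univ_succ]
  simp only [Fin.cons_zero, Fin.cons_succ, inc_zero_succ, inc_zero_zero, uv_zero, sum_hd]
  have : ∀ a : ℕ, (((d + 1 + 3 : ℕ) : ℤ) - a - 1 = 1) ↔ a = d + 2 := by
    intro a; push_cast; omega
  simp only [this]
  simp

theorem top_succ (d a b L m : ℕ) (ha' : a ≤ d + 3) (hb' : b ≤ d + 3) (v : Fin d → ℕ) (i : Fin d) :
    top (d + 1) a b L (Fin.cons m v) i.succ
      = top d (min a (d + 2)) (min b (d + 2)) m v i := by
  unfold top
  rw [Fin.sum_univ_succ]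
  simp only [Fin.cons_zero, Fin.cons_succ, inc_succ_zero, inc_succ_succ, uv_succ,
    uv_reduce d a ha', uv_reduce d b hb']
  rw [uv_nonpos d (1 - 1) (by norm_num)]
  have : uv d 1 i = if (i : ℕ) = 0 then 1 else 0 := by simp [uv]
  rw [this]
  ring

theorem par_cons (d a b m : ℕ) (ha : 1 ≤ a) (hb : 1 ≤ b) (ha' : a ≤ d + 3) (hb' : b ≤ d + 3)
    (v : Fin d → ℕ) :
    par (d + 1) a b (Fin.cons m v) ↔
      (m + min a (d + 2) + min b (d + 2)) % 2 = 0 ∧ par d (min a (d + 2)) (min b (d + 2)) v := by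
  unfold par
  rw [Fin.forall_fin_succ]
  apply and_congr
  · simp only [Fin.cons_zero, Fin.val_zero]
    omega
  · refine forall_congr' fun i => ?_
    simp only [Fin.cons_succ, Fin.val_succ]
    rw [show min (a - 1) (d + 1 + 3 - ((i : ℕ) + 1 + 1) - 2)
        = min (min a (d + 2) - 1) (d + 3 - ((i : ℕ) + 1) - 2) by omega,
      show min (b - 1) (d + 1 + 3 - ((i : ℕ) + 1 + 1) - 2)
        = min (min b (d + 2) - 1) (d + 3 - ((i : ℕ) + 1) - 2) by omega]

theorem T_cons (t : K) (ht : t ≠ 0) (d a b L m : ℕ) (ha : 1 ≤ a) (hb : 1 ≤ b) (ha' : a ≤ d + 3)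
    (hb' : b ≤ d + 3) (v : Fin d → ℕ) :
    T t (d + 1) a b L (Fin.cons m v) =
      if (m + min a (d + 2) + min b (d + 2)) % 2 = 0 then
        t ^ (2 * (m : ℤ) ^ 2 - 2 * (if a = d + 2 then 1 else 0) * m) *
        (t ^ (- 2 * (m : ℤ) * (hd d v : ℕ)) *
        gaussHalf t ((hd d v : ℕ) + L + (if a = d + 2 then 1 else 0) + (if b = d + 2 then 1 else 0)) m)
        * T t d (min a (d + 2)) (min b (d + 2)) m v
      else 0 := by
  unfold T
  simp only [par_cons d a b m ha hb ha' hb']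
  by_cases h1 : (m + min a (d + 2) + min b (d + 2)) % 2 = 0
  · by_cases h2 : par d (min a (d + 2)) (min b (d + 2)) v
    · rw [if_pos ⟨h1, h2⟩, if_pos h1, if_pos h2, Fin.prod_univ_succ, top_zero]
      simp only [Fin.cons_zero, Fin.cons_succ, top_succ d a b L m ha' hb', quadC_cons, mAt_cons]
      have e1 : mAt d v (((d + 1 + 3 : ℕ) : ℤ) - a - 1 - 1)
          = mAt d v (((d + 3 : ℕ) : ℤ) - (min a (d + 2) : ℕ) - 1) := by
        unfold mAt
        simp only [uv_reduce d a ha']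
      have e2 : (((d + 1 + 3 : ℕ) : ℤ) - a - 1 = 1) ↔ a = d + 2 := by
        push_cast; omega
      simp only [e1, e2]
      have e3 : ∀ (x y z w : ℤ) (A B C D E: K), x = y + z + w → 
          t ^ x * (A * B) = t ^ y * (t ^ z * A) * (t ^ w * B) := by
        intro x y z w A B _ _ _ h
        rw [h, zpow_add₀ ht, zpow_add₀ ht]
        ring
      apply e3 _ _ _ _ _ _ 0 0 0
      ring
    · rw [if_neg (fun h => h2 h.2), if_pos h1, if_neg h2, mul_zero]
  · rw [if_neg (fun h => h1 h.1), if_neg h1]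

theorem inc_weight (d : ℕ) (k : Fin d) :
    ∑ i : Fin d, (((i : ℕ) : ℤ) + 1) * (d - (i : ℕ)) * inc d i k
      = 2 * ((((k : ℕ) : ℤ) + 1) * (d - (k : ℕ))) - 2 := by
  have h1 : ∀ i : Fin d, (((i : ℕ) : ℤ) + 1) * (d - (i : ℕ)) * inc d i k
      = (fun j : ℕ => (if j + 1 = (k : ℕ) then ((j : ℤ) + 1) * (d - j) else 0)
        + (if (k : ℕ) + 1 = j then ((j : ℤ) + 1) * (d - j) else 0)) (i : ℕ) := by
    intro i
    simp only [inc]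
    by_cases ha : (i : ℕ) + 1 = k
    · rw [if_pos (Or.inl ha), if_pos ha, if_neg (by omega)]; ring
    · by_cases hb : (k : ℕ) + 1 = i
      · rw [if_pos (Or.inr hb), if_neg ha, if_pos hb]; ring
      · rw [if_neg (by omega), if_neg ha, if_neg hb]; ring
  rw [Finset.sum_congr rfl (fun i _ => h1 i), Fin.sum_univ_eq_sum_range (fun j : ℕ =>
    (if j + 1 = (k : ℕ) then ((j : ℤ) + 1) * (d - j) else 0)
        + (if (k : ℕ) + 1 = j then ((j : ℤ) + 1) * (d - j) else 0)), Finset.sum_add_distrib]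
  have hk := k.2
  have hA : ∑ j ∈ Finset.range d, (if j + 1 = (k : ℕ) then ((j : ℤ) + 1) * (d - j) else 0)
      = ((k : ℕ) : ℤ) * (d - (k : ℕ) + 1) := by
    rcases hk0 : (k : ℕ) with _ | k'
    · simp
    · rw [Finset.sum_eq_single k']
      · simp; left; ring
      · intro j _ hj; rw [if_neg (by omega)]
      · intro hj; simp at hj; omega
  have hB : ∑ j ∈ Finset.range d, (if (k : ℕ) + 1 = j then ((j : ℤ) + 1) * (d - j) else 0)
      = (((k : ℕ) : ℤ) + 2) * (d - (k : ℕ) - 1) := by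
    by_cases hkd : (k : ℕ) + 1 < d
    · rw [Finset.sum_ite_eq, if_pos (by simpa using hkd)]
      push_cast; ring
    · rw [Finset.sum_ite_eq, if_neg (by simpa using hkd)]
      have : (d : ℤ) = (k : ℕ) + 1 := by omega
      rw [this]; ring
  rw [hA, hB]
  ring

theorem T_finite (t : K) (d a b L : ℕ) : (Function.support (T t d a b L)).Finite := by
  set B : ℤ := ∑ i : Fin d, (((i : ℕ) : ℤ) + 1) * (d - (i : ℕ)) * (L + 2) with hB
  apply Set.Finite.subset (Set.Finite.pi (t := fun _ : Fin d => Set.Iic B.toNat)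
    (fun _ => Set.finite_Iic _))
  intro v hv
  rw [Set.mem_univ_pi]
  have h1 : ∀ i, 2 * (v i : ℤ) ≤ (∑ k, inc d i k * (v k : ℤ)) + (L + 2) := by
    intro i
    by_contra hc
    apply hv
    unfold T
    split_ifs
    · rw [Finset.prod_eq_zero (Finset.mem_univ i), mul_zero]
      apply gH_zero_of_lt
      have hu : ∀ s, uv d s i ≤ 1 := by intro s; unfold uv; split_ifs <;> norm_num
      have hL : (L : ℤ) * uv d 1 i ≤ L := by
        have := mul_le_mul_of_nonneg_left (hu 1) (Int.natCast_nonneg L)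
        simpa using this
      have h2 := hu (((d + 3 : ℕ) : ℤ) - a - 1)
      have h3 := hu (((d + 3 : ℕ) : ℤ) - b - 1)
      unfold top
      linarith
    · rfl
  have h2 : ∑ i : Fin d, (((i : ℕ) : ℤ) + 1) * (d - (i : ℕ)) * (2 * (v i : ℤ))
      ≤ ∑ i : Fin d, (((i : ℕ) : ℤ) + 1) * (d - (i : ℕ)) *
        ((∑ k, inc d i k * (v k : ℤ)) + (L + 2)) := by
    refine Finset.sum_le_sum fun i _ => mul_le_mul_of_nonneg_left (h1 i) ?_
    have := i.2
    apply mul_nonneg <;> omega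
  have h3 : ∑ i : Fin d, (((i : ℕ) : ℤ) + 1) * (d - (i : ℕ)) *
        ((∑ k, inc d i k * (v k : ℤ)) + (L + 2))
      = ∑ i : Fin d, (((i : ℕ) : ℤ) + 1) * (d - (i : ℕ)) * (2 * (v i : ℤ))
        - 2 * ∑ i : Fin d, (v i : ℤ) + B := by
    rw [Finset.sum_congr rfl (fun i _ => mul_add _ _ ((L : ℤ) + 2)), Finset.sum_add_distrib, ← hB]
    simp_rw [Finset.mul_sum]
    rw [Finset.sum_comm, ← Finset.sum_sub_distrib]
    congr 1
    refine Finset.sum_congr rfl fun k _ => ?_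
    have := inc_weight d k
    simp_rw [← mul_assoc]
    rw [← Finset.sum_mul, this]
    ring
  intro i
  have h4 : (v i : ℤ) ≤ ∑ i : Fin d, (v i : ℤ) :=
    Finset.single_le_sum (f := fun i => (v i : ℤ)) (fun i _ => Int.natCast_nonneg _)
      (Finset.mem_univ i)
  simp only [Set.mem_Iic]
  have h5 : (0 : ℤ) ≤ v i := Int.natCast_nonneg _
  omega

theorem main_induction (t : K) (ht : t ≠ 0) (hq : ∀ n, qp t n ≠ 0) (d : ℕ) :
    ∀ (a b L : ℕ) (f : ℕ → K), 1 ≤ a → a ≤ d + 2 → 1 ≤ b → b ≤ d + 2 → (L + a + b) % 2 = 0 →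
      ∑ᶠ v, f (hd d v) * T t d a b L v = ∑ m ∈ Finset.range (L + 2), f m * Z t d L a b m := by
  induction d with
  | zero =>
    intro a b L f ha ha' hb hb' hp
    rw [finsum_unique, Finset.sum_eq_single 0]
    · rw [Z_base t L a b 0 ha ha' hb hb' hp]
      simp [T, hd, par, quadC, mAt]
    · intro m _ hm
      rw [Z_base t L a b m ha ha' hb hb' hp, if_neg hm, mul_zero]
    · intro h; simp at h
  | succ d ih =>
    intro a b L f ha ha' hb hb' hp
    rw [← finsum_comp_equiv (Fin.consEquiv (fun _ : Fin (d + 1) => ℕ))]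
    rw [finsum_curry]
    · have inner : ∀ m : ℕ, ∑ᶠ v : Fin d → ℕ,
          f (hd (d + 1) (Fin.consEquiv (fun _ : Fin (d + 1) => ℕ) (m, v)))
            * T t (d + 1) a b L (Fin.consEquiv (fun _ : Fin (d + 1) => ℕ) (m, v))
          = f m * Z t (d + 1) L a b m := by
        intro m
        have e : ∀ v : Fin d → ℕ, Fin.consEquiv (fun _ : Fin (d + 1) => ℕ) (m, v)
          = (Fin.cons m v : Fin (d + 1) → ℕ) := fun _ => rfl
        have e2 : ∀ v : Fin d → ℕ, hd (d + 1) (Fin.cons m v : Fin (d + 1) → ℕ) = m := by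
          intro v; simp [hd]
        simp only [e, e2, T_cons t ht d a b L m ha hb ha' hb']
        rw [Z_step t ht hq d a b L m ha ha' hb hb']
        by_cases hm : (m + min a (d + 2) + min b (d + 2)) % 2 = 0
        · simp only [if_pos hm]
          have := ih (min a (d + 2)) (min b (d + 2)) m (fun μ => f m *
            (t ^ (2 * (m : ℤ) ^ 2 - 2 * (if a = d + 2 then 1 else 0) * m) *
            (t ^ (- 2 * (m : ℤ) * (μ : ℕ)) *
            gaussHalf t ((μ : ℕ) + L + (if a = d + 2 then 1 else 0)
              + (if b = d + 2 then 1 else 0)) m)))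
            (by omega) (by omega) (by omega) (by omega) hm
          simp only [mul_assoc] at this ⊢
          rw [this, Finset.mul_sum, Finset.mul_sum]
        · simp only [if_neg hm, mul_zero, finsum_zero]
          rw [Finset.sum_eq_zero, mul_zero, mul_zero]
          intro μ _
          rw [Z_parity t d m _ _ _ (by omega) (by omega) (by omega) (by omega) hm, mul_zero]
      rw [finsum_congr inner]
      apply finsum_eq_sum_of_support_subset
      intro m hm
      simp only [Finset.coe_range, Set.mem_Iio]
      by_contra hc
      apply hm
      simp only
      rw [Z_supp _ _ _ _ _ _ (by omega), mul_zero]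
    · have := (T_finite t (d + 1) a b L).preimage
        (Fin.consEquiv (fun _ : Fin (d + 1) => ℕ)).injective.injOn
      refine this.subset ?_
      intro p hp
      simp only [Set.mem_preimage, Function.mem_support] at hp ⊢
      exact right_ne_zero_of_mul hp

/-- unrefined path generating function -/
def V (t : K) (R : ℤ) (s : Bool) (h0 : ℤ) (n : ℕ) (dir : Bool) (h : ℤ) : K :=
  ∑ m ∈ Finset.range (n + 1), W t R s h0 n dir h m

theorem V_zero (t : K) (R : ℤ) (s : Bool) (h0 : ℤ) (dir : Bool) (h : ℤ) :
    V t R s h0 0 dir h = if dir = s ∧ h = h0 then 1 else 0 := by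
  unfold V
  rw [Finset.sum_range_one]
  simp [W]

theorem V_succ (t : K) (R : ℤ) (s : Bool) (h0 : ℤ) (n : ℕ) (dir : Bool) (h : ℤ) :
    V t R s h0 (n + 1) dir h = if 0 ≤ h ∧ h < R then
      V t R s h0 n (!dir) h + t ^ (2 * (n : ℤ)) * V t R s h0 n dir (h - sg dir) else 0 := by
  unfold V
  split_ifs with hh
  · simp only [W, if_pos hh]
    rw [Finset.sum_add_distrib, Finset.sum_range_succ, W_supp _ _ _ _ _ _ _ _ (Nat.lt_succ_self n),
      add_zero]
    congr 1
    rw [Finset.sum_range_succ', Finset.mul_sum]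
    simp
  · simp [W, if_neg hh]

theorem V_out (t : K) (R : ℤ) (s : Bool) (h0 : ℤ) (h0R : 0 ≤ h0 ∧ h0 < R) (n : ℕ) (dir : Bool)
    (h : ℤ) (hh : ¬ (0 ≤ h ∧ h < R)) : V t R s h0 n dir h = 0 :=
  Finset.sum_eq_zero fun _ _ => W_out _ _ _ _ h0R _ _ _ _ hh

/-- extension of a finite sequence by zero -/
def ext (r L : ℕ) (σ : Fin (L + 2) → Fin (r - 1)) (j : ℕ) : ℤ :=
  if h : j < L + 2 then ((σ ⟨j, h⟩ : ℕ) : ℤ) else 0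

/-- admissibility with integer end heights -/
def adm (L a : ℕ) (x y : ℤ) (s : ℕ → ℤ) : Prop :=
  (∀ j, j ≤ L → |s (j + 1) - s j| = 1) ∧ s 0 = (a : ℤ) - 1 ∧ s L = x ∧ s (L + 1) = y

/-- energy -/
def en (L : ℕ) (s : ℕ → ℤ) : ℤ := ∑ k ∈ Finset.Icc 1 L, (k : ℤ) * |s (k + 1) - s (k - 1)|

/-- configuration sum with integer end heights -/
def C (t : K) (r L a : ℕ) (x y : ℤ) : K :=
  ∑ σ : Fin (L + 2) → Fin (r - 1), if adm L a x y (ext r L σ) then t ^ en L (ext r L σ) else 0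

theorem conf_eq (r L a b c : ℕ) :
    conf r L a b c = C (RatFunc.X : RatFunc ℚ) r L a ((b : ℤ) - 1) ((c : ℤ) - 1) := by
  unfold conf C
  refine Finset.sum_congr rfl fun σ _ => ?_
  by_cases h : adm L a ((b : ℤ) - 1) ((c : ℤ) - 1) (ext r L σ)
  · rw [if_pos h]; exact if_pos h
  · rw [if_neg h]; exact if_neg h

theorem ext_snoc_lt (r L : ℕ) (σ : Fin (L + 2) → Fin (r - 1)) (p : Fin (r - 1)) (j : ℕ)
    (hj : j < L + 2) : ext r (L + 1) (Fin.snoc σ p : Fin (L + 3) → Fin (r - 1)) j = ext r L σ j := by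
  unfold ext
  rw [dif_pos (by omega), dif_pos hj]
  congr 2
  have : (⟨j, by omega⟩ : Fin (L + 3)) = Fin.castSucc (⟨j, hj⟩ : Fin (L + 2)) := rfl
  rw [this, Fin.snoc_castSucc (α := fun _ => Fin (r - 1))]

theorem ext_snoc_last (r L : ℕ) (σ : Fin (L + 2) → Fin (r - 1)) (p : Fin (r - 1)) :
    ext r (L + 1) (Fin.snoc σ p : Fin (L + 3) → Fin (r - 1)) (L + 2) = ((p : ℕ) : ℤ) := by
  unfold ext
  rw [dif_pos (by omega)]
  congr 2
  have : (⟨L + 2, by omega⟩ : Fin (L + 3)) = Fin.last (L + 2) := rfl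
  rw [this, Fin.snoc_last (α := fun _ => Fin (r - 1))]

theorem adm_snoc (r L a : ℕ) (x y : ℤ) (σ : Fin (L + 2) → Fin (r - 1)) (p : Fin (r - 1)) :
    adm (L + 1) a x y (ext r (L + 1) (Fin.snoc σ p : Fin (L + 3) → Fin (r - 1))) ↔
      (((p : ℕ) : ℤ) = y ∧ |y - x| = 1) ∧
      (adm L a (x - 1) x (ext r L σ) ∨ adm L a (x + 1) x (ext r L σ)) := by
  unfold adm
  rw [ext_snoc_lt _ _ _ _ 0 (by omega), ext_snoc_lt _ _ _ _ (L + 1) (by omega), ext_snoc_last]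
  constructor
  · rintro ⟨h1, h2, h3, h4⟩
    have h5 := h1 (L + 1) le_rfl
    rw [ext_snoc_last, ext_snoc_lt _ _ _ _ (L + 1) (by omega), h3, h4] at h5
    have h6 : ∀ j, j ≤ L → |ext r L σ (j + 1) - ext r L σ j| = 1 := by
      intro j hj
      have := h1 j (by omega)
      rwa [ext_snoc_lt _ _ _ _ _ (by omega), ext_snoc_lt _ _ _ _ _ (by omega)] at this
    refine ⟨⟨h4, h5⟩, ?_⟩
    have h7 := h6 L le_rfl
    rw [h3] at h7
    rcases (abs_eq (by norm_num)).1 h7 with h | h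
    · left; exact ⟨h6, h2, by omega, h3⟩
    · right; exact ⟨h6, h2, by omega, h3⟩
  · rintro ⟨⟨h1, h2⟩, h⟩
    obtain ⟨z, h3, h4, h5, h6⟩ : ∃ z, (∀ j, j ≤ L → |ext r L σ (j + 1) - ext r L σ j| = 1) ∧
        ext r L σ 0 = (a : ℤ) - 1 ∧ ext r L σ L = z ∧ ext r L σ (L + 1) = x := by
      rcases h with h | h
      · exact ⟨_, h⟩
      · exact ⟨_, h⟩
    refine ⟨?_, h4, h6, h1⟩
    intro j hj
    by_cases hj' : j ≤ L
    · rw [ext_snoc_lt _ _ _ _ _ (by omega), ext_snoc_lt _ _ _ _ _ (by omega)]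
      exact h3 j hj'
    · obtain rfl : j = L + 1 := by omega
      rw [ext_snoc_last, ext_snoc_lt _ _ _ _ (L + 1) (by omega), h6, h1, h2]

theorem en_snoc (r L : ℕ) (σ : Fin (L + 2) → Fin (r - 1)) (p : Fin (r - 1)) :
    en (L + 1) (ext r (L + 1) (Fin.snoc σ p : Fin (L + 3) → Fin (r - 1)))
      = en L (ext r L σ) + ((L : ℤ) + 1) * |((p : ℕ) : ℤ) - ext r L σ L| := by
  unfold en
  rw [Finset.sum_Icc_succ_top (by omega)]
  congr 1
  · refine Finset.sum_congr rfl fun k hk => ?_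
    rw [Finset.mem_Icc] at hk
    rw [ext_snoc_lt _ _ _ _ _ (by omega), ext_snoc_lt _ _ _ _ _ (by omega)]
  · rw [ext_snoc_last, ext_snoc_lt _ _ _ _ _ (by omega)]
    push_cast
    rfl

theorem C_succ (t : K) (ht : t ≠ 0) (r L a : ℕ) (hr : 1 ≤ r) (x y : ℤ) :
    C t r (L + 1) a x y = if (0 ≤ y ∧ y < (r : ℤ) - 1) ∧ |y - x| = 1 then
      t ^ (((L : ℤ) + 1) * |y - (x - 1)|) * C t r L a (x - 1) x
      + t ^ (((L : ℤ) + 1) * |y - (x + 1)|) * C t r L a (x + 1) x else 0 := by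
  unfold C
  rw [← (Fin.snocEquiv (fun _ : Fin (L + 3) => Fin (r - 1))).sum_comp, Fintype.sum_prod_type]
  have e : ∀ (p : Fin (r - 1)) (σ : Fin (L + 2) → Fin (r - 1)),
      Fin.snocEquiv (fun _ : Fin (L + 3) => Fin (r - 1)) (p, σ)
        = (Fin.snoc σ p : Fin (L + 3) → Fin (r - 1)) := fun _ _ => rfl
  have key : ∀ (p : Fin (r - 1)) (σ : Fin (L + 2) → Fin (r - 1)),
      (if adm (L + 1) a x y (ext r (L + 1) (Fin.snocEquiv (fun _ : Fin (L + 3) => Fin (r - 1)) (p, σ)))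
        then t ^ en (L + 1) (ext r (L + 1)
          (Fin.snocEquiv (fun _ : Fin (L + 3) => Fin (r - 1)) (p, σ))) else 0)
      = if ((p : ℕ) : ℤ) = y ∧ |y - x| = 1 then
        (t ^ (((L : ℤ) + 1) * |y - (x - 1)|) *
          (if adm L a (x - 1) x (ext r L σ) then t ^ en L (ext r L σ) else 0)
        + t ^ (((L : ℤ) + 1) * |y - (x + 1)|) *
          (if adm L a (x + 1) x (ext r L σ) then t ^ en L (ext r L σ) else 0)) else 0 := by
    intro p σ
    simp only [e, adm_snoc, en_snoc]
    by_cases h1 : ((p : ℕ) : ℤ) = y ∧ |y - x| = 1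
    · rw [if_pos h1]
      by_cases h2 : adm L a (x - 1) x (ext r L σ)
      · have h3 : ¬ adm L a (x + 1) x (ext r L σ) := by
          intro h3
          have h4 := h2.2.2.1
          have h5 := h3.2.2.1
          omega
        rw [if_pos ⟨h1, Or.inl h2⟩, if_pos h2, if_neg h3, h1.1, h2.2.2.1, zpow_add₀ ht]
        ring
      · by_cases h3 : adm L a (x + 1) x (ext r L σ)
        · rw [if_pos ⟨h1, Or.inr h3⟩, if_neg h2, if_pos h3, h1.1, h3.2.2.1, zpow_add₀ ht]
          ring
        · rw [if_neg (fun h => h.2.elim h2 h3), if_neg h2, if_neg h3]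
          ring
    · rw [if_neg h1, if_neg (fun h => h1 h.1)]
  simp only [key]
  by_cases hy : (0 ≤ y ∧ y < (r : ℤ) - 1) ∧ |y - x| = 1
  · rw [if_pos hy]
    have hlt : y.toNat < r - 1 := by omega
    rw [Finset.sum_eq_single (⟨y.toNat, hlt⟩ : Fin (r - 1))]
    · have : (((⟨y.toNat, hlt⟩ : Fin (r - 1)) : ℕ) : ℤ) = y ∧ |y - x| = 1 := by
        refine ⟨?_, hy.2⟩
        simp only
        omega
      simp only [if_pos this]
      rw [Finset.sum_add_distrib, Finset.mul_sum, Finset.mul_sum]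
    · intro p _ hp
      refine Finset.sum_eq_zero fun σ _ => ?_
      rw [if_neg]
      rintro ⟨h1, _⟩
      apply hp
      apply Fin.ext
      simp only
      omega
    · intro h; exact absurd (Finset.mem_univ _) h
  · rw [if_neg hy]
    refine Finset.sum_eq_zero fun p _ => Finset.sum_eq_zero fun σ _ => ?_
    rw [if_neg]
    rintro ⟨h1, h2⟩
    apply hy
    have := p.2
    refine ⟨⟨by omega, by omega⟩, h2⟩

theorem C_zero (t : K) (r a : ℕ) (x y : ℤ) :
    C t r 0 a x y = if (0 ≤ y ∧ y < (r : ℤ) - 1) ∧ (0 ≤ x ∧ x < (r : ℤ) - 1)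
      ∧ |y - x| = 1 ∧ x = (a : ℤ) - 1 then 1 else 0 := by
  unfold C
  have key : ∀ σ : Fin 2 → Fin (r - 1), (if adm 0 a x y (ext r 0 σ) then t ^ en 0 (ext r 0 σ) else 0)
      = if ((σ 0 : ℕ) : ℤ) = x ∧ ((σ 1 : ℕ) : ℤ) = y ∧ |y - x| = 1 ∧ x = (a : ℤ) - 1 then 1 else 0 := by
    intro σ
    have h0 : ext r 0 σ 0 = ((σ 0 : ℕ) : ℤ) := rfl
    have h1 : ext r 0 σ (0 + 1) = ((σ 1 : ℕ) : ℤ) := rfl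
    have : adm 0 a x y (ext r 0 σ) ↔
        (((σ 0 : ℕ) : ℤ) = x ∧ ((σ 1 : ℕ) : ℤ) = y ∧ |y - x| = 1 ∧ x = (a : ℤ) - 1) := by
      unfold adm
      constructor
      · rintro ⟨p1, p2, p3, p4⟩
        have p5 := p1 0 le_rfl
        rw [p3, p4] at p5
        rw [h0] at p2 p3
        rw [h1] at p4
        exact ⟨p3, p4, p5, by omega⟩
      · rintro ⟨p1, p2, p3, p4⟩
        refine ⟨?_, by rw [h0]; omega, by rw [h0]; omega, by rw [h1]; omega⟩
        intro j hj
        obtain rfl : j = 0 := by omega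
        rw [h0, h1, p1, p2, p3]
    simp only [this]
    simp [en]
  rw [Finset.sum_congr rfl (fun σ _ => key σ)]
  by_cases hc : (0 ≤ y ∧ y < (r : ℤ) - 1) ∧ (0 ≤ x ∧ x < (r : ℤ) - 1)
      ∧ |y - x| = 1 ∧ x = (a : ℤ) - 1
  · rw [if_pos hc]
    have hx : x.toNat < r - 1 := by omega
    have hy : y.toNat < r - 1 := by omega
    rw [Finset.sum_eq_single (![⟨x.toNat, hx⟩, ⟨y.toNat, hy⟩] : Fin 2 → Fin (r - 1))]
    · rw [if_pos]
      refine ⟨?_, ?_, hc.2.2⟩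
      · simp; omega
      · simp; omega
    · intro σ _ hσ
      rw [if_neg]
      rintro ⟨p1, p2, _⟩
      apply hσ
      funext i
      fin_cases i
      · apply Fin.ext; simp; omega
      · apply Fin.ext; simp; omega
    · intro h; exact absurd (Finset.mem_univ _) h
  · rw [if_neg hc]
    refine Finset.sum_eq_zero fun σ _ => ?_
    rw [if_neg]
    rintro ⟨p1, p2, p3⟩
    apply hc
    have := (σ 0).2
    have := (σ 1).2
    exact ⟨⟨by omega, by omega⟩, ⟨by omega, by omega⟩, p3⟩

theorem C_eq_V (t : K) (ht : t ≠ 0) (d a : ℕ) (ha : 1 ≤ a) (ha' : a ≤ d + 2) (L : ℕ) : ∀ x : ℤ,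
    C t (d + 3) L a x (x + 1) = V t (d + 1 : ℕ) (sdir (d + 1) a) (sh (d + 1) a) (L + 1) true x ∧
    C t (d + 3) L a (x + 1) x = V t (d + 1 : ℕ) (sdir (d + 1) a) (sh (d + 1) a) (L + 1) false x := by
  have hs := sh_range (d + 1) a (by omega) ha
  induction L with
  | zero =>
    intro x
    rw [V_succ, V_succ]
    simp only [V_zero, C_zero]
    have q1 : |x + 1 - x| = 1 := by simp
    have q2 : |x - (x + 1)| = 1 := by simp
    simp only [q1, q2, true_and]
    by_cases h1 : d + 1 < a
    · have e1 : sdir (d + 1) a = true := by simp [sdir]; omega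
      have e2 : sh (d + 1) a = ((d + 1 : ℕ) : ℤ) - 1 := by rw [sh, if_pos h1]
      rw [e1, e2]
      simp [sg]
      constructor
      · split_ifs <;> first | rfl | (exfalso; omega)
      · split_ifs <;> first | rfl | (exfalso; omega)
    · have e1 : sdir (d + 1) a = false := by simp [sdir]; omega
      have e2 : sh (d + 1) a = (a : ℤ) - 1 := by rw [sh, if_neg h1]
      rw [e1, e2]
      simp [sg]
      constructor
      · split_ifs <;> first | rfl | (exfalso; omega)
      · split_ifs <;> first | rfl | (exfalso; omega)
  | succ L ih =>
    intro x
    have i1 := ih x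
    have i2 := ih (x - 1)
    have i3 := ih (x + 1)
    rw [sub_add_cancel] at i2
    rw [V_succ t _ _ _ (L + 1) true x, V_succ t _ _ _ (L + 1) false x,
      C_succ t ht _ _ _ (by omega) x (x + 1), C_succ t ht _ _ _ (by omega) (x + 1) x]
    have q1 : |x + 1 - x| = 1 := by simp
    have q2 : |x - (x + 1)| = 1 := by simp
    have q3 : |x + 1 - (x - 1)| = 2 := by rw [show x + 1 - (x - 1) = 2 by ring]; norm_num
    have q4 : |x + 1 - (x + 1)| = 0 := by simp
    have q5 : |x - (x + 1 - 1)| = 0 := by simp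
    have q6 : |x - (x + 1 + 1)| = 2 := by rw [show x - (x + 1 + 1) = -2 by ring]; norm_num
    have s1 : x - sg true = x - 1 := by simp [sg]
    have s2 : x - sg false = x + 1 := by simp [sg]
    rw [q1, q2, q3, q4, q5, q6, i1.2, i2.1, i3.2, s1, s2, add_sub_cancel_right, i1.1]
    simp only [Bool.not_true, Bool.not_false, mul_zero, zpow_zero, one_mul, and_true]
    rw [show 2 * ((L + 1 : ℕ) : ℤ) = ((L : ℤ) + 1) * 2 by push_cast; ring]
    push_cast at hs ⊢
    constructor
    · by_cases hx : 0 ≤ x ∧ x < (d : ℤ) + 1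
      · rw [if_pos hx, if_pos (by omega), add_comm]
      · rw [if_neg hx]
        split_ifs with hc
        · rw [V_out _ _ _ _ hs _ _ _ (by omega), V_out _ _ _ _ hs _ _ _ (by omega)]
          simp
        · rfl
    · by_cases hx : 0 ≤ x ∧ x < (d : ℤ) + 1
      · rw [if_pos hx, if_pos (by omega)]
      · rw [if_neg hx]
        split_ifs with hc
        · rw [V_out _ _ _ _ hs _ _ _ (by omega), V_out _ _ _ _ hs _ _ _ (by omega)]
          simp
        · rfl

theorem qp_X_ne (n : ℕ) : qp (RatFunc.X : RatFunc ℚ) n ≠ 0 := by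
  unfold qp
  rw [Finset.prod_ne_zero_iff]
  intro k _ h
  have h1 : (RatFunc.X : RatFunc ℚ) ^ (4 * (k + 1)) = 1 := (sub_eq_zero.1 h).symm
  rw [← RatFunc.algebraMap_X, ← map_pow, ← map_one (algebraMap (Polynomial ℚ) (RatFunc ℚ))] at h1
  have h2 := RatFunc.algebraMap_injective ℚ h1
  have h3 := congrArg Polynomial.natDegree h2
  simp at h3

end ABF

/-- **Fermionic evaluation of the ABF one-dimensional configuration sums**:
`X_L(a,b) = Σ_{m ≡ Q_{a,b}} q^{(1/4)mᵀCm - (1/2)m_{r-a-1}} ∏_j [(1/2)(Im + Le_1 + e_{r-a-1} + e_{r-b-1})_j; m_j]`,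
stated in the variable `t = q^{1/4}` (all exponents multiplied by `4`). -/
theorem abf_fermionic (r a b L : ℕ) (hr : 3 ≤ r) (ha : 1 ≤ a) (ha' : a ≤ r - 1)
    (hb : 1 ≤ b) (hb' : b ≤ r - 2)
    (hL : |(a : ℤ) - b| ≤ (L : ℤ) ∧ ((L : ℤ) - |(a : ℤ) - b|) % 2 = 0) :
    conf r L a b (b + 1) = fermSum r a b L RatFunc.X := by
  obtain ⟨d, rfl⟩ : ∃ d, r = d + 3 := ⟨r - 3, by omega⟩
  have hp : (L + a + b) % 2 = 0 := by
    have h := hL.2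
    rcases abs_cases ((a : ℤ) - b) with h1 | h1 <;> omega
  have hX : (RatFunc.X : RatFunc ℚ) ≠ 0 := RatFunc.X_ne_zero
  rw [ABF.fermSum_eq, ABF.conf_eq]
  have key := ABF.main_induction (RatFunc.X : RatFunc ℚ) hX ABF.qp_X_ne d a b L (fun _ => 1) ha
    (by omega) hb (by omega) hp
  simp only [one_mul] at key
  rw [key]
  have h2 := (ABF.C_eq_V (RatFunc.X : RatFunc ℚ) hX d a ha (by omega) L ((b : ℤ) - 1)).1
  rw [show ((b + 1 : ℕ) : ℤ) - 1 = (b : ℤ) - 1 + 1 by push_cast; ring, h2]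
  unfold ABF.V ABF.Z
  simp only [if_pos (show b ≤ d + 1 by omega)]
end
end
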